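/- Under the stated assumptions on the Hermitian-matrix-valued solution g of the elliptic system, there exist α' ∈ (0,1) and a constant C, both depending only on n, α, σ, Λ and M, such that sup_{B_{1/2}} |g| + sup_{B_{1/2}} |Dg| + sup_{x≠y ∈ B_{1/2}} |Dg(x)−Dg(y)|/|x−y|^{α'} ≤ C, where Dg denotes the collection of all first-order (real) partial derivatives of all entries g_{ij̄}. -/

import Mathlib

open Matrix MeasureTheory

noncomputable instance (n : ℕ) : MeasurableSpace (EuclideanSpace ℂ (Fin n)) := borel _
instance (n : ℕ) : BorelSpace (EuclideanSpace ℂ (Fin n)) := ⟨rfl⟩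

/-- The real partial derivative `∂_{x_k} f` (direction of the real part of `z_k`). -/
noncomputable def pdx (n : ℕ) (k : Fin n) (f : EuclideanSpace ℂ (Fin n) → ℂ)
    (z : EuclideanSpace ℂ (Fin n)) : ℂ :=
  fderiv ℝ f z (EuclideanSpace.single k (1 : ℂ))

/-- The real partial derivative `∂_{y_k} f` (direction of the imaginary part of `z_k`). -/
noncomputable def pdy (n : ℕ) (k : Fin n) (f : EuclideanSpace ℂ (Fin n) → ℂ)
    (z : EuclideanSpace ℂ (Fin n)) : ℂ :=
  fderiv ℝ f z (EuclideanSpace.single k Complex.I)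

/-- The Wirtinger derivative `∂_k = ½(∂_{x_k} − i ∂_{y_k})`. -/
noncomputable def wirt (n : ℕ) (k : Fin n) (f : EuclideanSpace ℂ (Fin n) → ℂ)
    (z : EuclideanSpace ℂ (Fin n)) : ℂ :=
  (pdx n k f z - Complex.I * pdy n k f z) / 2

/-- The conjugate Wirtinger derivative `∂_{k̄} = ½(∂_{x_k} + i ∂_{y_k})`. -/
noncomputable def wirtBar (n : ℕ) (k : Fin n) (f : EuclideanSpace ℂ (Fin n) → ℂ)
    (z : EuclideanSpace ℂ (Fin n)) : ℂ :=
  (pdx n k f z + Complex.I * pdy n k f z) / 2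

/-- The hypotheses on the Hermitian-matrix-valued solution `g` of the elliptic system
`g^{kl̄} ∂_k ∂_{l̄} g_{ij̄} − g^{km̄} g^{pl̄} (∂_p g_{im̄})(∂_{l̄} g_{kj̄}) = c g_{ij̄} + H_{ij̄}`
on the unit ball `B₁ ⊆ ℂⁿ`:
smoothness of `g`, pointwise Hermitianity, the two-sided bound `σ⁻¹·Id ≤ g ≤ σ·Id`,
continuity of `H` together with `|c| + sup |H| ≤ Λ`, the `α`-Hölder bound `M` for `g`,
and the equation itself (with `g^{kl̄}` the entries of the pointwise inverse matrix). -/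
def EllipticSolution (n : ℕ) (α σ Λ M c : ℝ)
    (g H : EuclideanSpace ℂ (Fin n) → Matrix (Fin n) (Fin n) ℂ) : Prop :=
  (∀ i j : Fin n, ContDiffOn ℝ (⊤ : ℕ∞) (fun z => g z i j)
      (Metric.ball (0 : EuclideanSpace ℂ (Fin n)) 1)) ∧
  (∀ z ∈ Metric.ball (0 : EuclideanSpace ℂ (Fin n)) 1, (g z).IsHermitian) ∧
  (∀ z ∈ Metric.ball (0 : EuclideanSpace ℂ (Fin n)) 1, ∀ v : Fin n → ℂ,
      σ⁻¹ * (star v ⬝ᵥ v).re ≤ (star v ⬝ᵥ (g z).mulVec v).re ∧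
      (star v ⬝ᵥ (g z).mulVec v).re ≤ σ * (star v ⬝ᵥ v).re) ∧
  (∀ i j : Fin n, ContinuousOn (fun z => H z i j)
      (Metric.ball (0 : EuclideanSpace ℂ (Fin n)) 1)) ∧
  (∀ z ∈ Metric.ball (0 : EuclideanSpace ℂ (Fin n)) 1, ∀ i j : Fin n,
      |c| + ‖H z i j‖ ≤ Λ) ∧
  (∀ i j : Fin n, ∀ z ∈ Metric.ball (0 : EuclideanSpace ℂ (Fin n)) 1,
      ∀ y ∈ Metric.ball (0 : EuclideanSpace ℂ (Fin n)) 1,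
      ‖g z i j - g y i j‖ ≤ M * ‖z - y‖ ^ α) ∧
  (∀ z ∈ Metric.ball (0 : EuclideanSpace ℂ (Fin n)) 1, ∀ i j : Fin n,
      (∑ k : Fin n, ∑ l : Fin n,
        ((g z)⁻¹ l k) * wirt n k (fun w => wirtBar n l (fun w' => g w' i j) w) z)
      - (∑ k : Fin n, ∑ m : Fin n, ∑ p : Fin n, ∑ l : Fin n,
        ((g z)⁻¹ m k) * ((g z)⁻¹ l p) *
          wirt n p (fun w => g w i m) z * wirtBar n l (fun w => g w k j) z)
      = (c : ℂ) * g z i j + H z i j)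

section Calculus

open Metric Set Filter Topology
open scoped ContDiff

variable {E : Type*} [NormedAddCommGroup E] [NormedSpace ℝ E]

/-- The derivative of `f` along the complexified vector `p.1 + i p.2`. -/
noncomputable def cderiv (p : E × E) (f : E → ℂ) (z : E) : ℂ :=
  fderiv ℝ f z p.1 + Complex.I * fderiv ℝ f z p.2

theorem cderiv_real (e : E) (f : E → ℂ) (z : E) : cderiv (e, 0) f z = fderiv ℝ f z e := by
  simp [cderiv]

theorem norm_cderiv_le (p : E × E) (f : E → ℂ) (z : E) :
    ‖cderiv p f z‖ ≤ (‖p.1‖ + ‖p.2‖) * ‖fderiv ℝ f z‖ := by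
  unfold cderiv
  refine (norm_add_le _ _).trans ?_
  rw [norm_mul, Complex.norm_I, one_mul]
  have h1 := (fderiv ℝ f z).le_opNorm p.1
  have h2 := (fderiv ℝ f z).le_opNorm p.2
  linarith

theorem contDiff_cderiv (p : E × E) {f : E → ℂ} (hf : ContDiff ℝ ∞ f) :
    ContDiff ℝ ∞ (cderiv p f) := by
  have h : ContDiff ℝ ∞ (fderiv ℝ f) := hf.fderiv_right (by simp)
  unfold cderiv
  exact (h.clm_apply contDiff_const).add (contDiff_const.mul (h.clm_apply contDiff_const))

theorem cderiv_congr {p : E × E} {f g : E → ℂ} {z : E} (h : f =ᶠ[𝓝 z] g) :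
    cderiv p f z = cderiv p g z := by
  unfold cderiv; rw [h.fderiv_eq]

theorem cderiv_mul (p : E × E) {f g : E → ℂ} {z : E} (hf : DifferentiableAt ℝ f z)
    (hg : DifferentiableAt ℝ g z) :
    cderiv p (fun w => f w * g w) z = cderiv p f z * g z + f z * cderiv p g z := by
  unfold cderiv
  rw [fderiv_fun_mul hf hg]
  simp
  ring

theorem fderiv_cderiv (p : E × E) {f : E → ℂ} (hf : ContDiff ℝ ∞ f) (z v : E) :
    fderiv ℝ (cderiv p f) z v
      = fderiv ℝ (fderiv ℝ f) z v p.1 + Complex.I * fderiv ℝ (fderiv ℝ f) z v p.2 := by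
  have h : ContDiff ℝ ∞ (fderiv ℝ f) := hf.fderiv_right (by simp)
  have hd : DifferentiableAt ℝ (fderiv ℝ f) z := h.differentiable (by simp) z
  unfold cderiv
  have h1 : HasFDerivAt (fun w => fderiv ℝ f w p.1) _ z :=
    hd.hasFDerivAt.clm_apply (hasFDerivAt_const p.1 z)
  have h2 : HasFDerivAt (fun w => fderiv ℝ f w p.2) _ z :=
    hd.hasFDerivAt.clm_apply (hasFDerivAt_const p.2 z)
  have h3 : HasFDerivAt (fun w => fderiv ℝ f w p.1 + Complex.I * fderiv ℝ f w p.2) _ z :=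
    h1.add (h2.const_mul Complex.I)
  rw [h3.fderiv]
  simp

theorem cderiv_comm (p q : E × E) {f : E → ℂ} (hf : ContDiff ℝ ∞ f) (z : E) :
    cderiv p (cderiv q f) z = cderiv q (cderiv p f) z := by
  have hs : IsSymmSndFDerivAt ℝ f z :=
    (hf.contDiffAt (x := z)).isSymmSndFDerivAt
      (by simpa using WithTop.coe_le_coe.2 (le_top : (2 : ℕ∞) ≤ ⊤))
  have e1 : ∀ p q : E × E, cderiv p (cderiv q f) z = fderiv ℝ (cderiv q f) z p.1
    + Complex.I * fderiv ℝ (cderiv q f) z p.2 := fun _ _ => rfl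
  rw [e1, e1, fderiv_cderiv q hf, fderiv_cderiv q hf, fderiv_cderiv p hf, fderiv_cderiv p hf,
    hs.eq q.1 p.1, hs.eq q.1 p.2, hs.eq q.2 p.1, hs.eq q.2 p.2]
  ring

theorem cderiv_comp_affine (p : E × E) {f : E → ℂ} (hf : ContDiff ℝ ∞ f) (x : E) (r : ℝ)
    (y : E) : cderiv p (fun y => f (x + r • y)) y = r * cderiv p f (x + r • y) := by
  have hd : DifferentiableAt ℝ f (x + r • y) := hf.differentiable (by simp) _
  have h1 : HasFDerivAt (fun y : E => x + r • y) (r • ContinuousLinearMap.id ℝ E) y :=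
    ((hasFDerivAt_id y).const_smul r).const_add x
  have h2 : HasFDerivAt (fun y : E => f (x + r • y)) _ y := hd.hasFDerivAt.comp y h1
  unfold cderiv
  rw [h2.fderiv]
  simp
  ring

theorem contDiff_comp_affine {f : E → ℂ} (hf : ContDiff ℝ ∞ f) (x : E) (r : ℝ) :
    ContDiff ℝ ∞ (fun y => f (x + r • y)) :=
  hf.comp (contDiff_const.add (contDiff_const.smul contDiff_id))

theorem hasCompactSupport_cderiv (p : E × E) {f : E → ℂ} (hf : HasCompactSupport f) :
    HasCompactSupport (cderiv p f) := by
  have h := hf.fderiv (𝕜 := ℝ)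
  exact h.comp_left (g := fun T : E →L[ℝ] ℂ => T p.1 + Complex.I * T p.2) (by simp)

variable [FiniteDimensional ℝ E] [MeasurableSpace E] [BorelSpace E]
  (μ : Measure E) [μ.IsAddHaarMeasure]

theorem integral_cderiv_mul (p : E × E) {f h : E → ℂ} (hf : ContDiff ℝ ∞ f)
    (hh : ContDiff ℝ ∞ h) (hs : HasCompactSupport h) :
    ∫ y, cderiv p f y * h y ∂μ = - ∫ y, f y * cderiv p h y ∂μ := by
  have cf := hf.continuous
  have ch := hh.continuous
  have cf' : Continuous (fderiv ℝ f) := hf.continuous_fderiv (by simp)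
  have ch' : Continuous (fderiv ℝ h) := hh.continuous_fderiv (by simp)
  have hs' := hs.fderiv (𝕜 := ℝ)
  have i1 : ∀ v : E, Integrable (fun x ↦ fderiv ℝ f x v * h x) μ := fun v =>
    Continuous.integrable_of_hasCompactSupport (by fun_prop) hs.mul_left
  have i2 : ∀ v : E, Integrable (fun x ↦ f x * fderiv ℝ h x v) μ := fun v =>
    Continuous.integrable_of_hasCompactSupport (by fun_prop)
      (HasCompactSupport.mul_left (hs'.comp_left (g := fun T : E →L[ℝ] ℂ => T v) (by simp)))
  have i3 : Integrable (fun x ↦ f x * h x) μ :=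
    Continuous.integrable_of_hasCompactSupport (by fun_prop) hs.mul_left
  have key : ∀ v : E, ∫ x, fderiv ℝ f x v * h x ∂μ = - ∫ x, f x * fderiv ℝ h x v ∂μ := by
    intro v
    rw [integral_mul_fderiv_eq_neg_fderiv_mul_of_integrable (i1 v) (i2 v) i3
      (fun x _ => hf.differentiable (by simp) x) (fun x _ => hh.differentiable (by simp) x),
      neg_neg]
  have e1 : ∀ y, cderiv p f y * h y
      = fderiv ℝ f y p.1 * h y + Complex.I * (fderiv ℝ f y p.2 * h y) := by
    intro y; unfold cderiv; ring
  have e2 : ∀ y, f y * cderiv p h y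
      = f y * fderiv ℝ h y p.1 + Complex.I * (f y * fderiv ℝ h y p.2) := by
    intro y; unfold cderiv; ring
  simp_rw [e1, e2]
  rw [integral_add (i1 _) ((i1 _).const_mul _), integral_add (i2 _) ((i2 _).const_mul _),
    integral_const_mul, integral_const_mul, key, key]
  ring

omit [BorelSpace E] in
theorem norm_integral_le_of_eq_zero_off {f : E → ℂ} {ρ c : ℝ}
    (h0 : ∀ y, ρ < ‖y‖ → f y = 0) (h1 : ∀ y, ‖y‖ ≤ ρ → ‖f y‖ ≤ c) :
    ‖∫ y, f y ∂μ‖ ≤ c * μ.real (closedBall 0 ρ) := by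
  have : ∫ y, f y ∂μ = ∫ y in closedBall (0 : E) ρ, f y ∂μ := by
    refine (setIntegral_eq_integral_of_forall_compl_eq_zero ?_).symm
    intro y hy
    exact h0 y (by simpa using hy)
  rw [this]
  refine norm_setIntegral_le_of_norm_le_const ?_ ?_
  · exact (isCompact_closedBall (0 : E) ρ).measure_lt_top
  · intro y hy
    exact h1 y (by simpa using hy)

omit [FiniteDimensional ℝ E] in
theorem hasDerivAt_integral_comp_affine {w φ : E → ℂ} (hw : ContDiff ℝ ∞ w)
    (hφ : Continuous φ) (hs : HasCompactSupport φ) (x : E) (r : ℝ) :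
    HasDerivAt (fun r : ℝ => ∫ y, w (x + r • y) * φ y ∂μ)
      (∫ y, fderiv ℝ w (x + r • y) y * φ y ∂μ) r := by
  have cw := hw.continuous
  have cw' : Continuous (fderiv ℝ w) := hw.continuous_fderiv (by simp)
  set F' : ℝ → E → ℂ := fun s y => fderiv ℝ w (x + s • y) y * φ y with hF'
  have cF : Continuous (fun q : ℝ × E => F' q.1 q.2) := by
    rw [hF']; fun_prop
  have hK : IsCompact (closedBall r 1 ×ˢ tsupport φ) := (isCompact_closedBall r 1).prod hs
  obtain ⟨C, hC⟩ := hK.exists_bound_of_continuousOn cF.continuousOn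
  have hmeas : ∀ s : ℝ, Continuous (fun y : E => w (x + s • y) * φ y) := by intro s; fun_prop
  refine (hasDerivAt_integral_of_dominated_loc_of_deriv_le (F' := F')
    (bound := (tsupport φ).indicator (fun _ => C)) (ball_mem_nhds r one_pos) ?_ ?_ ?_ ?_ ?_ ?_).2
  · exact Eventually.of_forall fun s => (hmeas s).aestronglyMeasurable
  · exact (hmeas r).integrable_of_hasCompactSupport hs.mul_left
  · have : Continuous (F' r) := by rw [hF']; fun_prop
    exact this.aestronglyMeasurable
  · refine Eventually.of_forall fun y s hsr => ?_
    by_cases hy : y ∈ tsupport φ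
    · rw [indicator_of_mem hy]
      exact hC (s, y) ⟨ball_subset_closedBall hsr, hy⟩
    · rw [indicator_of_notMem hy, hF']
      simp [image_eq_zero_of_notMem_tsupport hy]
  · exact (integrable_indicator_iff (isClosed_tsupport φ).measurableSet).2
      (integrableOn_const hs.measure_lt_top.ne)
  · refine Eventually.of_forall fun y s _ => ?_
    have h1 : HasDerivAt (fun s : ℝ => x + s • y) y s := by
      simpa using ((hasDerivAt_id s).smul_const y).const_add x
    exact ((hw.differentiable (by simp) (x + s • y)).hasFDerivAt.comp_hasDerivAt s h1).mul_const _

end Calculus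

section Average

open Metric Set Filter Topology
open scoped ContDiff

variable {E : Type*} [NormedAddCommGroup E] [NormedSpace ℝ E]
  [FiniteDimensional ℝ E] [MeasurableSpace E] [BorelSpace E]
  (μ : Measure E) [μ.IsAddHaarMeasure] {ι : Type*} [Fintype ι]

/-- The weighted average `∫ (∂_e u)(x + r y) φ(y) dy` of a directional derivative. -/
noncomputable def derivAverage (u φ : E → ℂ) (e x : E) (r : ℝ) : ℂ :=
  ∫ y, fderiv ℝ u (x + r • y) e * φ y ∂μ

/-- The divergence-form operator `∑ i, ∂_{q i} (a i ∂_{p i} u)`. -/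
noncomputable def divForm (p q : ι → E × E) (a : ι → E → ℂ) (u : E → ℂ) (z : E) : ℂ :=
  ∑ i, cderiv (q i) (fun w => a i w * cderiv (p i) u w) z

theorem integral_cderiv_affine_mul {p q : E × E} {e x : E} {r : ℝ} (hr : r ≠ 0)
    {u a ψ : E → ℂ} (hu : ContDiff ℝ ∞ u) (ha : ContDiff ℝ ∞ a) (hψ : ContDiff ℝ ∞ ψ)
    (hs : HasCompactSupport ψ) :
    a x * ∫ y, cderiv p (cderiv (e, 0) u) (x + r • y) * cderiv q ψ y ∂μ
      = - (r : ℂ)⁻¹ * ∫ y, (a x - a (x + r • y)) * cderiv p u (x + r • y)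
          * cderiv q (cderiv (e, 0) ψ) y ∂μ
        + ∫ y, cderiv q (fun w => a w * cderiv p u w) (x + r • y) * cderiv (e, 0) ψ y ∂μ := by
  have hr' : (r : ℂ) ≠ 0 := by exact_mod_cast hr
  have hV := contDiff_comp_affine (contDiff_cderiv p hu) x r
  have hA := contDiff_comp_affine ha x r
  have hAV := contDiff_comp_affine (ha.mul (contDiff_cderiv p hu)) x r
  have hqψ := contDiff_cderiv q hψ
  have hh := contDiff_cderiv (e, 0) hψ
  have hsq := hasCompactSupport_cderiv q hs
  have hsh := hasCompactSupport_cderiv (e, 0) hs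
  have hqh := contDiff_cderiv q hh
  have hsqh := hasCompactSupport_cderiv q hsh
  have s1 : ∫ y, cderiv p (cderiv (e, 0) u) (x + r • y) * cderiv q ψ y ∂μ
      = - (r : ℂ)⁻¹ * ∫ y, cderiv p u (x + r • y) * cderiv q (cderiv (e, 0) ψ) y ∂μ := by
    have := integral_cderiv_mul μ (e, 0) hV hqψ hsq
    simp_rw [cderiv_comp_affine (e, 0) (contDiff_cderiv p hu), cderiv_comm (e, 0) p hu,
      cderiv_comm (e, 0) q hψ, mul_assoc, integral_const_mul] at this
    rw [neg_mul, ← mul_neg, ← this, inv_mul_cancel_left₀ hr']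
  have s2 : (r : ℂ) * ∫ y, cderiv q (fun w => a w * cderiv p u w) (x + r • y)
        * cderiv (e, 0) ψ y ∂μ
      = - ∫ y, a (x + r • y) * cderiv p u (x + r • y) * cderiv q (cderiv (e, 0) ψ) y ∂μ := by
    have := integral_cderiv_mul μ q hAV hh hsh
    simp_rw [cderiv_comp_affine q (ha.mul (contDiff_cderiv p hu)), mul_assoc,
      integral_const_mul] at this
    simp_rw [mul_assoc]
    exact this
  have i1 : Integrable (fun y => a x * (cderiv p u (x + r • y)
      * cderiv q (cderiv (e, 0) ψ) y)) μ :=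
    ((hV.continuous.mul hqh.continuous).integrable_of_hasCompactSupport
      hsqh.mul_left).const_mul _
  have i2 : Integrable (fun y => a (x + r • y) * cderiv p u (x + r • y)
      * cderiv q (cderiv (e, 0) ψ) y) μ :=
    (hAV.continuous.mul hqh.continuous).integrable_of_hasCompactSupport hsqh.mul_left
  have s3 : ∫ y, (a x - a (x + r • y)) * cderiv p u (x + r • y)
          * cderiv q (cderiv (e, 0) ψ) y ∂μ
      = a x * ∫ y, cderiv p u (x + r • y) * cderiv q (cderiv (e, 0) ψ) y ∂μ
        - ∫ y, a (x + r • y) * cderiv p u (x + r • y) * cderiv q (cderiv (e, 0) ψ) y ∂μ := by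
    rw [← integral_const_mul, ← integral_sub i1 i2]
    congr 1; ext y; ring
  rw [s1, s3, ← neg_eq_iff_eq_neg.2 s2]
  field_simp
  ring

theorem hasDerivAt_derivAverage {p q : ι → E × E} {a : ι → E → ℂ} {u ψ φ : E → ℂ}
    (hu : ContDiff ℝ ∞ u) (ha : ∀ i, ContDiff ℝ ∞ (a i)) (hψ : ContDiff ℝ ∞ ψ)
    (hs : HasCompactSupport ψ) (hφ : Continuous φ) (hsφ : HasCompactSupport φ) (e x : E)
    (euler : ∀ (T : E →L[ℝ] ℂ) (y : E), φ y * T y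
      = - ∑ i, a i x * ((T (p i).1 + Complex.I * T (p i).2) * cderiv (q i) ψ y))
    {r : ℝ} (hr : r ≠ 0) :
    HasDerivAt (derivAverage μ u φ e x)
      ((r : ℂ)⁻¹ * (∑ i, ∫ y, (a i x - a i (x + r • y)) * cderiv (p i) u (x + r • y)
          * cderiv (q i) (cderiv (e, 0) ψ) y ∂μ)
        - ∫ y, divForm p q a u (x + r • y) * cderiv (e, 0) ψ y ∂μ) r := by
  have hw : ContDiff ℝ ∞ (cderiv (e, 0) u) := contDiff_cderiv _ hu
  have hd := hasDerivAt_integral_comp_affine μ hw hφ hsφ x r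
  have hfun : derivAverage μ u φ e x
      = fun r : ℝ => ∫ y, cderiv (e, 0) u (x + r • y) * φ y ∂μ := by
    ext r; simp only [derivAverage, cderiv_real]
  rw [hfun]
  convert hd using 1
  have hpt : ∀ y, fderiv ℝ (cderiv (e, 0) u) (x + r • y) y * φ y
      = - ∑ i, a i x * (cderiv (p i) (cderiv (e, 0) u) (x + r • y) * cderiv (q i) ψ y) := by
    intro y
    rw [mul_comm, euler]
    rfl
  simp_rw [hpt]
  have int1 : ∀ i, Integrable (fun y => a i x *
      (cderiv (p i) (cderiv (e, 0) u) (x + r • y) * cderiv (q i) ψ y)) μ := fun i =>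
    (((contDiff_comp_affine (contDiff_cderiv (p i) hw) x r).continuous.mul
      (contDiff_cderiv (q i) hψ).continuous).integrable_of_hasCompactSupport
      (hasCompactSupport_cderiv (q i) hs).mul_left).const_mul _
  have int2 : ∀ i, Integrable (fun y => cderiv (q i) (fun w => a i w * cderiv (p i) u w)
      (x + r • y) * cderiv (e, 0) ψ y) μ := fun i =>
    ((contDiff_comp_affine (contDiff_cderiv (q i)
      ((ha i).mul (contDiff_cderiv (p i) hu))) x r).continuous.mul
      (contDiff_cderiv (e, 0) hψ).continuous).integrable_of_hasCompactSupport
      (hasCompactSupport_cderiv (e, 0) hs).mul_left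
  rw [integral_neg, integral_finsetSum _ (fun i _ => int1 i)]
  simp_rw [integral_const_mul, integral_cderiv_affine_mul μ hr hu (ha _) hψ hs, divForm,
    Finset.sum_mul]
  rw [integral_finsetSum _ (fun i _ => int2 i), Finset.sum_add_distrib, ← Finset.mul_sum]
  ring

omit [FiniteDimensional ℝ E] [BorelSpace E] [μ.IsAddHaarMeasure] in
theorem derivAverage_zero (u φ : E → ℂ) (e x : E) :
    derivAverage μ u φ e x 0 = fderiv ℝ u x e * ∫ y, φ y ∂μ := by
  simp [derivAverage, integral_const_mul]

omit [FiniteDimensional ℝ E] in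
theorem continuous_derivAverage {u φ : E → ℂ} (hu : ContDiff ℝ ∞ u)
    (hφ : Continuous φ) (hsφ : HasCompactSupport φ) (e x : E) :
    Continuous (derivAverage μ u φ e x) := by
  have hw : ContDiff ℝ ∞ (cderiv (e, 0) u) := contDiff_cderiv _ hu
  have hfun : derivAverage μ u φ e x
      = fun r : ℝ => ∫ y, cderiv (e, 0) u (x + r • y) * φ y ∂μ := by
    ext r; simp only [derivAverage, cderiv_real]
  rw [hfun, continuous_iff_continuousAt]
  exact fun r => (hasDerivAt_integral_comp_affine μ hw hφ hsφ x r).continuousAt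

theorem derivAverage_eq_neg_integral {u φ : E → ℂ} (hu : ContDiff ℝ ∞ u)
    (hφ : ContDiff ℝ ∞ φ) (hsφ : HasCompactSupport φ) (e x : E) {r : ℝ} (hr : r ≠ 0) (c : ℂ) :
    derivAverage μ u φ e x r
      = - (r : ℂ)⁻¹ * ∫ y, (u (x + r • y) - c) * cderiv (e, 0) φ y ∂μ := by
  have hr' : (r : ℂ) ≠ 0 := by exact_mod_cast hr
  have hc : ContDiff ℝ ∞ (fun z => u z - c) := hu.sub contDiff_const
  have := integral_cderiv_mul μ (e, 0) (contDiff_comp_affine hc x r) hφ hsφ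
  simp_rw [cderiv_comp_affine (e, 0) hc, mul_assoc, integral_const_mul] at this
  rw [neg_mul, ← mul_neg, ← this, inv_mul_cancel_left₀ hr', derivAverage]
  congr 1; ext y
  rw [cderiv_real, fderiv_sub_const]

end Average

section AverageBounds

open Metric Set Filter Topology
open scoped ContDiff

variable {E : Type*} [NormedAddCommGroup E] [NormedSpace ℝ E]
  [FiniteDimensional ℝ E] [MeasurableSpace E] [BorelSpace E]
  (μ : Measure E) [μ.IsAddHaarMeasure] {ι : Type*} [Fintype ι]

theorem norm_sub_le_of_deriv_le_rpow {J J' : ℝ → ℂ} {α P F R : ℝ} (hα : 0 < α) (hP : 0 ≤ P)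
    (hF : 0 ≤ F) (hR : 0 < R) (hc : Continuous J) (hd : ∀ r, 0 < r → HasDerivAt J (J' r) r)
    (hb : ∀ r, 0 < r → r ≤ R → ‖J' r‖ ≤ P * r ^ (α - 1) + F) :
    ‖J R - J 0‖ ≤ P * R ^ α / α + F * R := by
  set Bf : ℝ → ℝ := fun r => P * r ^ α / α + F * r with hBf
  have hBd : ∀ r, 0 < r → HasDerivAt Bf (P * r ^ (α - 1) + F) r := by
    intro r hr
    have h1 := ((Real.hasDerivAt_rpow_const (p := α) (Or.inl hr.ne')).const_mul P).div_const α
    have h2 := h1.add ((hasDerivAt_id r).const_mul F)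
    have e : P * (α * r ^ (α - 1)) / α + F * 1 = P * r ^ (α - 1) + F := by
      field_simp
    rw [← e]
    exact h2
  have step : ∀ ε, 0 < ε → ε < R → ‖J R - J ε‖ ≤ Bf R := by
    intro ε hε hεR
    have hpos : 0 ≤ Bf ε := by simp only [hBf]; positivity
    have := image_norm_le_of_norm_deriv_right_le_deriv_boundary'
      (f := fun s => J s - J ε) (f' := J') (a := ε) (b := R) (B := fun s => Bf s - Bf ε)
      (B' := fun r => P * r ^ (α - 1) + F)
      (by fun_prop)
      (fun r hr => ((hd r (hε.trans_le hr.1)).sub_const _).hasDerivWithinAt)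
      (by simp)
      (fun r hr => ((hBd r (hε.trans_le hr.1)).continuousAt.sub
        continuousAt_const).continuousWithinAt)
      (fun r hr => ((hBd r (hε.trans_le hr.1)).sub_const _).hasDerivWithinAt)
      (fun r hr => hb r (hε.trans_le hr.1) hr.2.le)
      (x := R) ⟨hεR.le, le_rfl⟩
    linarith
  have lim : Tendsto (fun ε => ‖J R - J ε‖) (𝓝[>] 0) (𝓝 ‖J R - J 0‖) :=
    ((continuous_const.sub hc).norm.tendsto 0).mono_left nhdsWithin_le_nhds
  refine le_of_tendsto lim ?_
  filter_upwards [Ioo_mem_nhdsGT hR] with ε hε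
  exact step ε hε.1 hε.2

theorem norm_derivAverage_sub_le {p q : ι → E × E} {a : ι → E → ℂ} {u ψ φ : E → ℂ}
    (hu : ContDiff ℝ ∞ u) (ha : ∀ i, ContDiff ℝ ∞ (a i)) (hψ : ContDiff ℝ ∞ ψ)
    (hs : HasCompactSupport ψ) (hφ : Continuous φ) (hsφ : HasCompactSupport φ) (e x : E)
    (euler : ∀ (T : E →L[ℝ] ℂ) (y : E), φ y * T y
      = - ∑ i, a i x * ((T (p i).1 + Complex.I * T (p i).2) * cderiv (q i) ψ y))
    {α ρ B A L F R : ℝ} (hα : 0 < α) (hρ : 0 ≤ ρ) (hB : 0 ≤ B) (hA : 0 ≤ A) (hL : 0 ≤ L)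
    (hF : 0 ≤ F) (hR : 0 < R)
    (h0 : ∀ y, ρ < ‖y‖ → cderiv (e, 0) ψ y = 0)
    (h0' : ∀ i y, ρ < ‖y‖ → cderiv (q i) (cderiv (e, 0) ψ) y = 0)
    (h1 : ∀ y, ‖y‖ ≤ ρ → ‖cderiv (e, 0) ψ y‖ ≤ B)
    (h1' : ∀ i y, ‖y‖ ≤ ρ → ‖cderiv (q i) (cderiv (e, 0) ψ) y‖ ≤ B)
    (hLu : ∀ i, ∀ z ∈ closedBall x (R * ρ), ‖cderiv (p i) u z‖ ≤ L)
    (hFu : ∀ z ∈ closedBall x (R * ρ), ‖divForm p q a u z‖ ≤ F)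
    (hAa : ∀ i, ∀ z ∈ closedBall x (R * ρ), ‖a i x - a i z‖ ≤ A * ‖x - z‖ ^ α) :
    ‖derivAverage μ u φ e x R - fderiv ℝ u x e * ∫ y, φ y ∂μ‖
      ≤ Fintype.card ι * (A * ρ ^ α * L * B * μ.real (closedBall 0 ρ)) * R ^ α / α
        + F * B * μ.real (closedBall 0 ρ) * R := by
  rw [← derivAverage_zero]
  refine norm_sub_le_of_deriv_le_rpow hα (by positivity) (by positivity) hR
    (continuous_derivAverage μ hu hφ hsφ e x)
    (fun r hr => hasDerivAt_derivAverage μ hu ha hψ hs hφ hsφ e x euler hr.ne') ?_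
  intro r hr hrR
  have hmem : ∀ y : E, ‖y‖ ≤ ρ → x + r • y ∈ closedBall x (R * ρ) := by
    intro y hy
    rw [mem_closedBall, dist_eq_norm, add_sub_cancel_left, norm_smul, Real.norm_of_nonneg hr.le]
    exact mul_le_mul hrR hy (norm_nonneg _) hR.le
  refine (norm_sub_le _ _).trans (add_le_add ?_ ?_)
  · have hi : ∀ i, ‖∫ y, (a i x - a i (x + r • y)) * cderiv (p i) u (x + r • y)
          * cderiv (q i) (cderiv (e, 0) ψ) y ∂μ‖
          ≤ A * (r * ρ) ^ α * L * B * μ.real (closedBall 0 ρ) := by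
      intro i
      refine norm_integral_le_of_eq_zero_off μ (fun y hy => by rw [h0' i y hy, mul_zero]) ?_
      intro y hy
      rw [norm_mul, norm_mul]
      have e1 : ‖a i x - a i (x + r • y)‖ ≤ A * (r * ρ) ^ α := by
        refine (hAa i _ (hmem y hy)).trans ?_
        have : ‖x - (x + r • y)‖ = r * ‖y‖ := by
          rw [sub_add_cancel_left, norm_neg, norm_smul, Real.norm_of_nonneg hr.le]
        rw [this]
        gcongr
      exact mul_le_mul (mul_le_mul e1 (hLu i _ (hmem y hy)) (norm_nonneg _) (by positivity))
        (h1' i y hy) (norm_nonneg _) (by positivity)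
    rw [norm_mul, norm_inv, Complex.norm_real, Real.norm_of_nonneg hr.le]
    have hsum := (norm_sum_le Finset.univ (fun i => ∫ y, (a i x - a i (x + r • y))
      * cderiv (p i) u (x + r • y) * cderiv (q i) (cderiv (e, 0) ψ) y ∂μ)).trans
      (Finset.sum_le_sum fun i _ => hi i)
    rw [Finset.sum_const, Finset.card_univ, nsmul_eq_mul] at hsum
    refine (mul_le_mul_of_nonneg_left hsum (by positivity)).trans (le_of_eq ?_)
    rw [Real.mul_rpow hr.le hρ, Real.rpow_sub_one hr.ne']
    ring
  · refine norm_integral_le_of_eq_zero_off μ (fun y hy => by rw [h0 y hy, mul_zero]) ?_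
    intro y hy
    rw [norm_mul]
    exact mul_le_mul (hFu _ (hmem y hy)) (h1 y hy) (norm_nonneg _) hF

theorem norm_derivAverage_le {u φ : E → ℂ} (hu : ContDiff ℝ ∞ u)
    (hφ : ContDiff ℝ ∞ φ) (hsφ : HasCompactSupport φ) (e x : E) {ρ B D R : ℝ} (hR : 0 < R)
    (hD : 0 ≤ D) (h0 : ∀ y, ρ < ‖y‖ → cderiv (e, 0) φ y = 0)
    (h1 : ∀ y, ‖y‖ ≤ ρ → ‖cderiv (e, 0) φ y‖ ≤ B)
    (hu1 : ∀ y, ‖y‖ ≤ ρ → ‖u (x + R • y) - u x‖ ≤ D) :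
    ‖derivAverage μ u φ e x R‖ ≤ R⁻¹ * (D * B * μ.real (closedBall 0 ρ)) := by
  rw [derivAverage_eq_neg_integral μ hu hφ hsφ e x hR.ne' (u x), norm_mul, norm_neg, norm_inv,
    Complex.norm_real, Real.norm_of_nonneg hR.le]
  gcongr
  refine norm_integral_le_of_eq_zero_off μ (fun y hy => by rw [h0 y hy, mul_zero]) ?_
  intro y hy
  rw [norm_mul]
  exact mul_le_mul (hu1 y hy) (h1 y hy) (norm_nonneg _) hD

theorem norm_derivAverage_translate_sub_le {u φ : E → ℂ} (hu : ContDiff ℝ ∞ u)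
    (hφ : ContDiff ℝ ∞ φ) (hsφ : HasCompactSupport φ) (e x x' : E) {ρ B D R : ℝ} (hR : 0 < R)
    (hD : 0 ≤ D) (h0 : ∀ y, ρ < ‖y‖ → cderiv (e, 0) φ y = 0)
    (h1 : ∀ y, ‖y‖ ≤ ρ → ‖cderiv (e, 0) φ y‖ ≤ B)
    (hu1 : ∀ y, ‖y‖ ≤ ρ → ‖u (x + R • y) - u (x' + R • y)‖ ≤ D) :
    ‖derivAverage μ u φ e x R - derivAverage μ u φ e x' R‖
      ≤ R⁻¹ * (D * B * μ.real (closedBall 0 ρ)) := by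
  have h_integ : ∀ z : E, Integrable (fun y => (u (z + R • y) - 0) * cderiv (e, 0) φ y) μ :=
    fun z => (((contDiff_comp_affine hu z R).continuous.sub continuous_const).mul
      (contDiff_cderiv (e, 0) hφ).continuous).integrable_of_hasCompactSupport
      (hasCompactSupport_cderiv (e, 0) hsφ).mul_left
  rw [derivAverage_eq_neg_integral μ hu hφ hsφ e x hR.ne' 0,
    derivAverage_eq_neg_integral μ hu hφ hsφ e x' hR.ne' 0, ← mul_sub,
    ← integral_sub (h_integ x) (h_integ x'), norm_mul, norm_neg, norm_inv,
    Complex.norm_real, Real.norm_of_nonneg hR.le]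
  gcongr
  refine norm_integral_le_of_eq_zero_off μ (fun y hy => by rw [h0 y hy]; ring) ?_
  intro y hy
  rw [← sub_mul, norm_mul]
  refine mul_le_mul ?_ (h1 y hy) (norm_nonneg _) hD
  simpa using hu1 y hy

theorem norm_derivAverage_kernel_sub_le {u φ φ' : E → ℂ} (hu : ContDiff ℝ ∞ u)
    (hφ : Continuous φ) (hsφ : HasCompactSupport φ) (hφ' : Continuous φ')
    (hsφ' : HasCompactSupport φ') (e x : E) {ρ D L R : ℝ} (hL : 0 ≤ L)
    (h0 : ∀ y, ρ < ‖y‖ → φ y = 0) (h0' : ∀ y, ρ < ‖y‖ → φ' y = 0)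
    (h1 : ∀ y, ‖y‖ ≤ ρ → ‖φ y - φ' y‖ ≤ D)
    (hu1 : ∀ y, ‖y‖ ≤ ρ → ‖fderiv ℝ u (x + R • y) e‖ ≤ L) :
    ‖derivAverage μ u φ e x R - derivAverage μ u φ' e x R‖
      ≤ L * D * μ.real (closedBall 0 ρ) := by
  have cu : Continuous (fderiv ℝ u) := hu.continuous_fderiv (by simp)
  have h_integ : ∀ φ : E → ℂ, Continuous φ → HasCompactSupport φ →
      Integrable (fun y => fderiv ℝ u (x + R • y) e * φ y) μ :=
    fun φ h h' => Continuous.integrable_of_hasCompactSupport (by fun_prop) h'.mul_left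
  unfold derivAverage
  rw [← integral_sub (h_integ φ hφ hsφ) (h_integ φ' hφ' hsφ')]
  refine norm_integral_le_of_eq_zero_off μ (fun y hy => by rw [h0 y hy, h0' y hy]; ring) ?_
  intro y hy
  rw [← mul_sub, norm_mul]
  exact mul_le_mul (hu1 y hy) (h1 y hy) (norm_nonneg _) hL

end AverageBounds

section Kernel

open Metric Set Filter Topology
open scoped ContDiff

/-- A smooth cutoff function on the line: `1` on `[-1, 1]` and `0` off `(-2, 2)`. -/
noncomputable def profile (s : ℝ) : ℝ :=
  (⟨1, 2, one_pos, one_lt_two⟩ : ContDiffBump (0 : ℝ)) s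

/-- The primitive of `-profile` vanishing on `[2, ∞)`. -/
noncomputable def profilePrim (s : ℝ) : ℝ := ∫ t in s..2, profile t

theorem contDiff_profile : ContDiff ℝ ∞ profile := ContDiffBump.contDiff _

theorem profile_nonneg (s : ℝ) : 0 ≤ profile s := ContDiffBump.nonneg _

theorem profile_le_one (s : ℝ) : profile s ≤ 1 := ContDiffBump.le_one _

theorem profile_eq_one {s : ℝ} (h0 : 0 ≤ s) (h1 : s ≤ 1) : profile s = 1 :=
  ContDiffBump.one_of_mem_closedBall _ (by simpa [abs_of_nonneg h0] using h1)

theorem profile_eq_zero {s : ℝ} (h : 2 ≤ s) : profile s = 0 :=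
  ContDiffBump.zero_of_le_dist _ (by
    simpa [Real.dist_eq] using h.trans (le_abs_self s))

theorem deriv_profile_eq_zero {s : ℝ} (h : 2 < s) : deriv profile s = 0 := by
  have : profile =ᶠ[𝓝 s] fun _ => 0 := by
    filter_upwards [Ioi_mem_nhds h] with t ht using profile_eq_zero (le_of_lt ht)
  rw [this.deriv_eq]; simp

theorem exists_deriv_profile_bound : ∃ K : ℝ, 1 ≤ K ∧ ∀ s, ‖deriv profile s‖ ≤ K := by
  have hs : HasCompactSupport profile := ContDiffBump.hasCompactSupport _
  have hc : Continuous (deriv profile) := contDiff_profile.continuous_deriv (by simp)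
  obtain ⟨K, hK⟩ := hs.deriv.exists_bound_of_continuous hc
  exact ⟨max K 1, le_max_right _ _, fun s => (hK s).trans (le_max_left _ _)⟩

theorem abs_profile_sub_le {K : ℝ} (hK : ∀ s, ‖deriv profile s‖ ≤ K) (s t : ℝ) :
    |profile s - profile t| ≤ K * |s - t| :=
  convex_univ.norm_image_sub_le_of_norm_deriv_le
    (fun x _ => contDiff_profile.differentiable (by simp) x) (fun x _ => hK x)
    (mem_univ t) (mem_univ s)

theorem hasDerivAt_profilePrim (s : ℝ) : HasDerivAt profilePrim (-profile s) s :=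
  intervalIntegral.integral_hasDerivAt_left
    (contDiff_profile.continuous.intervalIntegrable _ _)
    contDiff_profile.continuous.stronglyMeasurable.stronglyMeasurableAtFilter
    contDiff_profile.continuous.continuousAt

theorem contDiff_profilePrim : ContDiff ℝ ∞ profilePrim := by
  rw [contDiff_infty_iff_deriv]
  refine ⟨fun s => (hasDerivAt_profilePrim s).differentiableAt, ?_⟩
  have : deriv profilePrim = fun s => -profile s :=
    funext fun s => (hasDerivAt_profilePrim s).deriv
  rw [this]
  exact contDiff_profile.neg

theorem profilePrim_eq_zero {s : ℝ} (h : 2 ≤ s) : profilePrim s = 0 := by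
  unfold profilePrim
  rw [intervalIntegral.integral_symm, intervalIntegral.integral_congr (g := fun _ => (0 : ℝ))]
  · simp
  · intro t ht
    rw [uIcc_of_le h] at ht
    exact profile_eq_zero ht.1

variable {E : Type*} [NormedAddCommGroup E] [NormedSpace ℝ E]

/-- The kernel `y ↦ f (B(y, y) / 2)` attached to a bilinear form `B`. -/
noncomputable def quadKernel (f : ℝ → ℝ) (B : E →L[ℝ] E →L[ℝ] ℝ) (y : E) : ℂ :=
  (f (B y y / 2) : ℂ)

theorem contDiff_quadKernel {f : ℝ → ℝ} (hf : ContDiff ℝ ∞ f) (B : E →L[ℝ] E →L[ℝ] ℝ) :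
    ContDiff ℝ ∞ (quadKernel f B) := by
  have h : ContDiff ℝ ∞ (fun y => B y y / 2) :=
    (B.contDiff.clm_apply contDiff_id).div_const 2
  exact Complex.ofRealCLM.contDiff.comp (hf.comp h)

theorem cderiv_quadKernel {f f' : ℝ → ℝ} (hf : ∀ s, HasDerivAt f (f' s) s)
    {B : E →L[ℝ] E →L[ℝ] ℝ} (hB : ∀ x y, B x y = B y x) (p : E × E) (y : E) :
    cderiv p (quadKernel f B) y
      = (f' (B y y / 2) : ℂ) * (B y p.1 + Complex.I * B y p.2) := by
  have h1 : HasFDerivAt (fun y => B y y) (B y + B.flip y) y := by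
    exact B.hasFDerivAt.clm_apply (hasFDerivAt_id y)
  have h2 : HasFDerivAt (fun y => B y y / 2) (B y) y := by
    have h := h1.mul_const (2⁻¹ : ℝ)
    have e : (2⁻¹ : ℝ) • (B y + B.flip y) = B y := by
      refine ContinuousLinearMap.ext fun v => ?_
      simp [hB v y]
      ring
    rw [← e]
    exact h
  have h3 : HasFDerivAt (fun y => f (B y y / 2)) (f' (B y y / 2) • B y) y :=
    (hf _).comp_hasFDerivAt y h2
  have h4 : HasFDerivAt (quadKernel f B) (Complex.ofRealCLM.comp (f' (B y y / 2) • B y)) y :=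
    Complex.ofRealCLM.hasFDerivAt.comp y h3
  unfold cderiv
  rw [h4.fderiv]
  simp
  ring

theorem hasDerivAt_profile (s : ℝ) : HasDerivAt profile (deriv profile s) s :=
  (contDiff_profile.differentiable (by simp) s).hasDerivAt

theorem cderiv_cderiv_quadKernel_profilePrim {B : E →L[ℝ] E →L[ℝ] ℝ}
    (hB : ∀ x y, B x y = B y x) (p : E × E) (e y : E) :
    cderiv p (cderiv (e, 0) (quadKernel profilePrim B)) y
      = -(((deriv profile (B y y / 2) : ℝ) : ℂ) * (B y p.1 + Complex.I * B y p.2) * B y e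
        + (profile (B y y / 2) : ℂ) * (B p.1 e + Complex.I * B p.2 e)) := by
  have h1 : cderiv (e, 0) (quadKernel profilePrim B)
      = fun y => quadKernel profile B y * (-(B y e : ℂ)) := by
    ext y
    rw [cderiv_quadKernel hasDerivAt_profilePrim hB]
    simp [quadKernel]
  have h2 : HasFDerivAt (fun y => (-(B y e : ℂ))) (-(Complex.ofRealCLM.comp (B.flip e))) y :=
    (Complex.ofRealCLM.comp (B.flip e)).hasFDerivAt.neg
  rw [h1, cderiv_mul p ((contDiff_quadKernel contDiff_profile B).differentiable (by simp) y)
    h2.differentiableAt, cderiv_quadKernel hasDerivAt_profile hB]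
  have h3 : cderiv p (fun y => (-(B y e : ℂ))) y = -(B p.1 e + Complex.I * B p.2 e) := by
    unfold cderiv
    rw [h2.fderiv]
    simp
    ring
  rw [h3]
  simp only [quadKernel]
  ring

theorem norm_bilin_add_le {B : E →L[ℝ] E →L[ℝ] ℝ} {b : ℝ} (hb : ‖B‖ ≤ b) (p : E × E)
    (hp : ‖p.1‖ + ‖p.2‖ ≤ 1) (y : E) :
    ‖((B y p.1 : ℂ) + Complex.I * B y p.2)‖ ≤ b * ‖y‖ := by
  have h : ∀ v, ‖(B y v : ℂ)‖ ≤ b * ‖y‖ * ‖v‖ := by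
    intro v
    rw [Complex.norm_real]
    exact (B.le_opNorm₂ y v).trans (by gcongr)
  refine (norm_add_le _ _).trans ?_
  rw [norm_mul, Complex.norm_I, one_mul]
  have hb0 : 0 ≤ b * ‖y‖ := mul_nonneg ((norm_nonneg B).trans hb) (norm_nonneg _)
  nlinarith [h p.1, h p.2]

/-- A bound for the kernels attached to bilinear forms of norm at most `b` and for their
derivatives on the ball of radius `ρ`. -/
def kernelBound (K b ρ : ℝ) : ℝ := K * ((b * ρ) ^ 2 + b * ρ + b)

section Bounds

variable {B : E →L[ℝ] E →L[ℝ] ℝ} {K b ρ : ℝ}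

theorem norm_cderiv_quadKernel_profile_le (hK1 : 1 ≤ K) (hK : ∀ s, ‖deriv profile s‖ ≤ K)
    (hB : ∀ x y, B x y = B y x) (hb : ‖B‖ ≤ b) {e : E} (he : ‖e‖ ≤ 1) {y : E} (hy : ‖y‖ ≤ ρ) :
    ‖cderiv (e, 0) (quadKernel profile B) y‖ ≤ kernelBound K b ρ := by
  have hb0 : 0 ≤ b := (norm_nonneg B).trans hb
  have hρ0 : 0 ≤ ρ := (norm_nonneg _).trans hy
  rw [cderiv_quadKernel hasDerivAt_profile hB, norm_mul, Complex.norm_real]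
  have h1 := norm_bilin_add_le hb (e, 0) (by simpa using he) y
  calc _ ≤ K * (b * ρ) := mul_le_mul (hK _) (h1.trans (by gcongr)) (norm_nonneg _) (by linarith)
    _ ≤ _ := by
      unfold kernelBound
      gcongr
      nlinarith [sq_nonneg (b * ρ)]

theorem norm_cderiv_quadKernel_profilePrim_le (hK1 : 1 ≤ K)
    (hB : ∀ x y, B x y = B y x) (hb : ‖B‖ ≤ b) {e : E} (he : ‖e‖ ≤ 1) {y : E} (hy : ‖y‖ ≤ ρ) :
    ‖cderiv (e, 0) (quadKernel profilePrim B) y‖ ≤ kernelBound K b ρ := by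
  have hb0 : 0 ≤ b := (norm_nonneg B).trans hb
  have hρ0 : 0 ≤ ρ := (norm_nonneg _).trans hy
  rw [cderiv_quadKernel hasDerivAt_profilePrim hB, norm_mul, Complex.norm_real, norm_neg,
    Real.norm_of_nonneg (profile_nonneg _)]
  have h1 := norm_bilin_add_le hb (e, 0) (by simpa using he) y
  calc _ ≤ K * (b * ρ) := mul_le_mul ((profile_le_one _).trans hK1) (h1.trans (by gcongr))
        (norm_nonneg _) (by linarith)
    _ ≤ _ := by
      unfold kernelBound
      gcongr
      nlinarith [sq_nonneg (b * ρ)]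

theorem norm_cderiv_cderiv_quadKernel_le (hK1 : 1 ≤ K) (hK : ∀ s, ‖deriv profile s‖ ≤ K)
    (hB : ∀ x y, B x y = B y x) (hb : ‖B‖ ≤ b) {e : E} (he : ‖e‖ ≤ 1) {p : E × E}
    (hp : ‖p.1‖ + ‖p.2‖ ≤ 1) {y : E} (hy : ‖y‖ ≤ ρ) :
    ‖cderiv p (cderiv (e, 0) (quadKernel profilePrim B)) y‖ ≤ kernelBound K b ρ := by
  have hb0 : 0 ≤ b := (norm_nonneg B).trans hb
  have hρ0 : 0 ≤ ρ := (norm_nonneg _).trans hy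
  rw [cderiv_cderiv_quadKernel_profilePrim hB, norm_neg]
  have h1 : ‖((B y p.1 : ℂ) + Complex.I * B y p.2)‖ ≤ b * ρ :=
    (norm_bilin_add_le hb p hp y).trans (by gcongr)
  have h2 : ‖((B p.1 e : ℂ) + Complex.I * B p.2 e)‖ ≤ b := by
    rw [hB p.1 e, hB p.2 e]
    exact (norm_bilin_add_le hb p hp e).trans (by nlinarith)
  have h3 : ‖(B y e : ℂ)‖ ≤ b * ρ := by
    rw [Complex.norm_real]
    refine (B.le_opNorm₂ y e).trans ?_
    calc ‖B‖ * ‖y‖ * ‖e‖ ≤ b * ρ * 1 := by gcongr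
      _ = b * ρ := mul_one _
  have h4 : ‖((deriv profile (B y y / 2) : ℝ) : ℂ)‖ ≤ K := by
    rw [Complex.norm_real]; exact hK _
  have h5 : ‖((profile (B y y / 2) : ℝ) : ℂ)‖ ≤ K := by
    rw [Complex.norm_real, Real.norm_of_nonneg (profile_nonneg _)]
    exact (profile_le_one _).trans hK1
  refine (norm_add_le _ _).trans ?_
  rw [norm_mul, norm_mul, norm_mul]
  calc _ ≤ K * (b * ρ) * (b * ρ) + K * b := by gcongr
    _ ≤ _ := by
      unfold kernelBound
      have : 0 ≤ K * (b * ρ) := by positivity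
      nlinarith

theorem norm_quadKernel_profile_sub_le {B' : E →L[ℝ] E →L[ℝ] ℝ} {β : ℝ}
    (hK : ∀ s, ‖deriv profile s‖ ≤ K) (hβ : ‖B - B'‖ ≤ β) {y : E} (hy : ‖y‖ ≤ ρ) :
    ‖quadKernel profile B y - quadKernel profile B' y‖ ≤ K * ρ ^ 2 * β := by
  have hβ0 : 0 ≤ β := (norm_nonneg (B - B')).trans hβ
  have hK0 : 0 ≤ K := (norm_nonneg _).trans (hK 0)
  have hρ0 : 0 ≤ ρ := (norm_nonneg _).trans hy
  unfold quadKernel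
  rw [← Complex.ofReal_sub, Complex.norm_real]
  refine (abs_profile_sub_le hK _ _).trans ?_
  have h1 : |B y y / 2 - B' y y / 2| ≤ ρ ^ 2 * β := by
    have h2 := (B - B').le_opNorm₂ y y
    have h3 : (B - B') y y = B y y - B' y y := rfl
    rw [h3, Real.norm_eq_abs] at h2
    rw [← sub_div, abs_div, abs_two]
    have h4 : ‖B - B'‖ * ‖y‖ * ‖y‖ ≤ β * ρ * ρ := by gcongr
    have h5 := abs_nonneg (B y y - B' y y)
    nlinarith
  calc _ ≤ K * (ρ ^ 2 * β) := by gcongr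
    _ = _ := by ring

variable (hc : ∀ y : E, ρ < ‖y‖ → 2 < B y y / 2)
include hc

theorem quadKernel_eq_zero {f : ℝ → ℝ} (hf : ∀ s, 2 < s → f s = 0) {y : E} (hy : ρ < ‖y‖) :
    quadKernel f B y = 0 := by
  simp [quadKernel, hf _ (hc y hy)]

theorem cderiv_quadKernel_eq_zero {f f' : ℝ → ℝ} (hf : ∀ s, HasDerivAt f (f' s) s)
    (hf0 : ∀ s, 2 < s → f' s = 0) (hB : ∀ x y, B x y = B y x) (p : E × E)
    {y : E} (hy : ρ < ‖y‖) : cderiv p (quadKernel f B) y = 0 := by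
  rw [cderiv_quadKernel hf hB, hf0 _ (hc y hy)]
  simp

theorem cderiv_cderiv_quadKernel_eq_zero (hB : ∀ x y, B x y = B y x) (p : E × E) (e : E)
    {y : E} (hy : ρ < ‖y‖) : cderiv p (cderiv (e, 0) (quadKernel profilePrim B)) y = 0 := by
  rw [cderiv_cderiv_quadKernel_profilePrim hB, deriv_profile_eq_zero (hc y hy),
    profile_eq_zero (hc y hy).le]
  simp

variable [FiniteDimensional ℝ E]

theorem hasCompactSupport_quadKernel {f : ℝ → ℝ} (hf : ∀ s, 2 < s → f s = 0) :
    HasCompactSupport (quadKernel f B) :=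
  HasCompactSupport.intro (isCompact_closedBall (0 : E) ρ) fun y hy =>
    quadKernel_eq_zero hc hf (by simpa using hy)

variable [MeasurableSpace E] [BorelSpace E] (μ : Measure E) [μ.IsAddHaarMeasure]

theorem le_norm_integral_quadKernel {r : ℝ} (hpos : ∀ y, 0 ≤ B y y)
    (hr : ∀ y : E, ‖y‖ ≤ r → B y y / 2 ≤ 1) :
    μ.real (closedBall 0 r) ≤ ‖∫ y, quadKernel profile B y ∂μ‖ := by
  have h_integ : Integrable (fun y => quadKernel profile B y) μ :=
    (contDiff_quadKernel contDiff_profile B).continuous.integrable_of_hasCompactSupport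
      (hasCompactSupport_quadKernel hc fun s hs => profile_eq_zero hs.le)
  have hre : Integrable (fun y => profile (B y y / 2)) μ := h_integ.re
  have h1 : ∫ y, quadKernel profile B y ∂μ = ((∫ y, profile (B y y / 2) ∂μ : ℝ) : ℂ) :=
    integral_ofReal
  rw [h1, Complex.norm_real, Real.norm_of_nonneg (integral_nonneg fun y => profile_nonneg _)]
  calc μ.real (closedBall 0 r) = ∫ y in closedBall (0 : E) r, (1 : ℝ) ∂μ := by simp
    _ = ∫ y in closedBall (0 : E) r, profile (B y y / 2) ∂μ := by
      refine setIntegral_congr_fun measurableSet_closedBall fun y hy => ?_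
      exact (profile_eq_one (by have := hpos y; positivity) (hr y (by simpa using hy))).symm
    _ ≤ _ := setIntegral_le_integral hre (Eventually.of_forall fun y => profile_nonneg _)

omit [BorelSpace E] in
theorem norm_integral_quadKernel_sub_le {B' : E →L[ℝ] E →L[ℝ] ℝ} {β : ℝ}
    (hc' : ∀ y : E, ρ < ‖y‖ → 2 < B' y y / 2) [BorelSpace E]
    (hK : ∀ s, ‖deriv profile s‖ ≤ K) (hβ : ‖B - B'‖ ≤ β) :
    ‖∫ y, quadKernel profile B y ∂μ - ∫ y, quadKernel profile B' y ∂μ‖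
      ≤ K * ρ ^ 2 * β * μ.real (closedBall 0 ρ) := by
  have hz : ∀ s : ℝ, 2 < s → profile s = 0 := fun s hs => profile_eq_zero hs.le
  rw [← integral_sub
    ((contDiff_quadKernel contDiff_profile B).continuous.integrable_of_hasCompactSupport
      (hasCompactSupport_quadKernel hc hz))
    ((contDiff_quadKernel contDiff_profile B').continuous.integrable_of_hasCompactSupport
      (hasCompactSupport_quadKernel hc' hz))]
  refine norm_integral_le_of_eq_zero_off μ (fun y hy => ?_)
    (fun y hy => norm_quadKernel_profile_sub_le hK hβ hy)
  rw [quadKernel_eq_zero hc hz hy, quadKernel_eq_zero hc' hz hy, sub_zero]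

end Bounds

end Kernel

section Wirtinger

open Metric Set Filter Topology ComplexConjugate
open scoped ContDiff

variable {n : ℕ}

/-- The complexified vector along which `cderiv` is the Wirtinger derivative `∂_k`. -/
noncomputable def wirtVec (k : Fin n) : EuclideanSpace ℂ (Fin n) × EuclideanSpace ℂ (Fin n) :=
  ((1 / 2 : ℝ) • EuclideanSpace.single k 1, (-(1 / 2) : ℝ) • EuclideanSpace.single k Complex.I)

/-- The complexified vector along which `cderiv` is the Wirtinger derivative `∂_{k̄}`. -/
noncomputable def wirtBarVec (k : Fin n) : EuclideanSpace ℂ (Fin n) × EuclideanSpace ℂ (Fin n) :=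
  ((1 / 2 : ℝ) • EuclideanSpace.single k 1, (1 / 2 : ℝ) • EuclideanSpace.single k Complex.I)

theorem wirt_eq_cderiv (k : Fin n) (f : EuclideanSpace ℂ (Fin n) → ℂ)
    (z : EuclideanSpace ℂ (Fin n)) : wirt n k f z = cderiv (wirtVec k) f z := by
  simp only [wirt, pdx, pdy, cderiv, wirtVec, map_smul, Complex.real_smul]
  push_cast
  ring

theorem wirtBar_eq_cderiv (k : Fin n) (f : EuclideanSpace ℂ (Fin n) → ℂ)
    (z : EuclideanSpace ℂ (Fin n)) : wirtBar n k f z = cderiv (wirtBarVec k) f z := by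
  simp only [wirtBar, pdx, pdy, cderiv, wirtBarVec, map_smul, Complex.real_smul]
  push_cast
  ring

theorem norm_wirtVec (k : Fin n) : ‖(wirtVec k).1‖ + ‖(wirtVec k).2‖ ≤ 1 := by
  simp only [wirtVec, norm_smul, PiLp.norm_single]
  norm_num

theorem norm_wirtBarVec (k : Fin n) : ‖(wirtBarVec k).1‖ + ‖(wirtBarVec k).2‖ ≤ 1 := by
  simp only [wirtBarVec, norm_smul, PiLp.norm_single]
  norm_num

theorem apply_eq_sum_wirtVec (T : EuclideanSpace ℂ (Fin n) →L[ℝ] ℂ)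
    (y : EuclideanSpace ℂ (Fin n)) :
    T y = ∑ k, (y k * (T (wirtVec k).1 + Complex.I * T (wirtVec k).2)
      + conj (y k) * (T (wirtBarVec k).1 + Complex.I * T (wirtBarVec k).2)) := by
  have hy : y = ∑ k, ((y k).re • EuclideanSpace.single k (1 : ℂ)
      + (y k).im • EuclideanSpace.single k Complex.I) := by
    ext j
    simp only [WithLp.ofLp_sum, WithLp.ofLp_add, WithLp.ofLp_smul, Finset.sum_apply, Pi.add_apply,
      Pi.smul_apply, PiLp.ofLp_single]
    rw [Finset.sum_eq_single j]
    · simp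
    · intro b _ hb
      simp [hb.symm]
    · simp
  conv_lhs => rw [hy]
  rw [map_sum]
  refine Finset.sum_congr rfl fun k _ => ?_
  simp only [wirtVec, wirtBarVec, map_add, map_smul, Complex.real_smul]
  have h1 : y k = (y k).re + (y k).im * Complex.I := (Complex.re_add_im _).symm
  have h2 : conj (y k) = (y k).re - (y k).im * Complex.I := by
    apply Complex.ext <;> simp
  rw [h2]
  nth_rewrite 3 [h1]
  push_cast
  linear_combination ((y k).im * T (EuclideanSpace.single k Complex.I)) * Complex.I_sq

/-- The real bilinear form `(y, e) ↦ 2 Re ∑ A_{kl} y_k conj(e_l)`. -/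
noncomputable def hermBilin (A : Fin n → Fin n → ℂ) :
    EuclideanSpace ℂ (Fin n) →L[ℝ] EuclideanSpace ℂ (Fin n) →L[ℝ] ℝ :=
  LinearMap.mkContinuous₂
    (LinearMap.mk₂ ℝ (fun y e => 2 * (∑ k, ∑ l, A k l * y k * conj (e l)).re)
      (by
        intro y y' e
        rw [← mul_add, ← Complex.add_re]
        simp only [← Finset.sum_add_distrib, WithLp.ofLp_add, Pi.add_apply, add_mul, mul_add])
      (by
        intro c y e
        simp only [WithLp.ofLp_smul, Pi.smul_apply, Complex.real_smul, Complex.re_sum,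
          smul_eq_mul, Finset.mul_sum]
        refine Finset.sum_congr rfl fun k _ => Finset.sum_congr rfl fun l _ => ?_
        rw [show A k l * (c * y k) * conj (e l) = c * (A k l * y k * conj (e l)) by ring,
          Complex.re_ofReal_mul]
        ring)
      (by
        intro y e e'
        rw [← mul_add, ← Complex.add_re]
        simp only [← Finset.sum_add_distrib, WithLp.ofLp_add, Pi.add_apply, map_add, mul_add])
      (by
        intro c y e
        simp only [WithLp.ofLp_smul, Pi.smul_apply, Complex.real_smul, Complex.re_sum,
          smul_eq_mul, Finset.mul_sum, map_mul, Complex.conj_ofReal]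
        refine Finset.sum_congr rfl fun k _ => Finset.sum_congr rfl fun l _ => ?_
        rw [show A k l * y k * (c * conj (e l)) = c * (A k l * y k * conj (e l)) by ring,
          Complex.re_ofReal_mul]
        ring))
    (2 * ∑ k, ∑ l, ‖A k l‖)
    (by
      intro y e
      rw [LinearMap.mk₂_apply, norm_mul, Real.norm_ofNat, mul_assoc, mul_assoc]
      gcongr
      refine (Complex.abs_re_le_norm _).trans ?_
      simp_rw [Finset.sum_mul]
      refine norm_sum_le_of_le _ fun k _ => norm_sum_le_of_le _ fun l _ => ?_
      rw [norm_mul, norm_mul, RCLike.norm_conj, mul_assoc]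
      gcongr
      · exact PiLp.norm_apply_le y k
      · exact PiLp.norm_apply_le e l)

theorem hermBilin_apply (A : Fin n → Fin n → ℂ) (y e : EuclideanSpace ℂ (Fin n)) :
    hermBilin A y e = 2 * (∑ k, ∑ l, A k l * y k * conj (e l)).re := rfl

theorem norm_hermBilin_le (A : Fin n → Fin n → ℂ) {c : ℝ} (hA : ∀ k l, ‖A k l‖ ≤ c) :
    ‖hermBilin A‖ ≤ 2 * (n ^ 2 * c) := by
  refine (LinearMap.mkContinuous₂_norm_le _ (by positivity) _).trans ?_
  have : ∑ k, ∑ l, ‖A k l‖ ≤ ∑ k : Fin n, ∑ l : Fin n, c :=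
    Finset.sum_le_sum fun k _ => Finset.sum_le_sum fun l _ => hA k l
  simp only [Finset.sum_const, Finset.card_univ, Fintype.card_fin, nsmul_eq_mul] at this
  linarith

theorem hermBilin_sub (A A' : Fin n → Fin n → ℂ) :
    hermBilin A - hermBilin A' = hermBilin (fun k l => A k l - A' k l) := by
  ext y e
  simp only [_root_.sub_apply, hermBilin_apply, ← mul_sub, ← Complex.sub_re,
    ← Finset.sum_sub_distrib, sub_mul]

theorem hermBilin_symm {A : Fin n → Fin n → ℂ} (hA : ∀ k l, conj (A k l) = A l k)
    (y e : EuclideanSpace ℂ (Fin n)) : hermBilin A y e = hermBilin A e y := by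
  rw [hermBilin_apply, hermBilin_apply, ← Complex.conj_re (∑ k, ∑ l, A k l * y k * conj (e l)),
    Finset.sum_comm]
  simp only [map_sum, map_mul, hA, Complex.conj_conj]
  congr 2
  exact Finset.sum_congr rfl fun k _ => Finset.sum_congr rfl fun l _ => by ring

theorem hermBilin_single (A : Fin n → Fin n → ℂ) (y : EuclideanSpace ℂ (Fin n)) (l : Fin n)
    (c : ℂ) : hermBilin A y (EuclideanSpace.single l c)
      = 2 * ((∑ k, A k l * y k) * conj c).re := by
  rw [hermBilin_apply, Finset.sum_mul]
  congr 2
  refine Finset.sum_congr rfl fun k _ => ?_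
  rw [Finset.sum_eq_single l]
  · simp
  · intro b _ hb
    simp [hb]
  · simp

theorem hermBilin_wirtBarVec (A : Fin n → Fin n → ℂ) (y : EuclideanSpace ℂ (Fin n))
    (l : Fin n) : (hermBilin A y (wirtBarVec l).1 : ℂ)
      + Complex.I * hermBilin A y (wirtBarVec l).2 = ∑ k, A k l * y k := by
  simp only [wirtBarVec, map_smul, hermBilin_single, smul_eq_mul]
  apply Complex.ext <;> simp

theorem hermBilin_wirtVec (A : Fin n → Fin n → ℂ) (y : EuclideanSpace ℂ (Fin n))
    (l : Fin n) : (hermBilin A y (wirtVec l).1 : ℂ)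
      + Complex.I * hermBilin A y (wirtVec l).2 = conj (∑ k, A k l * y k) := by
  simp only [wirtVec, map_smul, hermBilin_single, smul_eq_mul]
  generalize ∑ k, A k l * y k = s
  apply Complex.ext <;> simp

/-- The first differentiation vectors in the divergence-form operator of the system. -/
noncomputable def outerVec (i : (Fin n × Fin n) × Bool) :
    EuclideanSpace ℂ (Fin n) × EuclideanSpace ℂ (Fin n) :=
  if i.2 then wirtBarVec i.1.2 else wirtVec i.1.1

/-- The second differentiation vectors in the divergence-form operator of the system. -/
noncomputable def innerVec (i : (Fin n × Fin n) × Bool) :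
    EuclideanSpace ℂ (Fin n) × EuclideanSpace ℂ (Fin n) :=
  if i.2 then wirtVec i.1.1 else wirtBarVec i.1.2

theorem norm_outerVec (i : (Fin n × Fin n) × Bool) : ‖(outerVec i).1‖ + ‖(outerVec i).2‖ ≤ 1 := by
  unfold outerVec; split_ifs <;> [exact norm_wirtBarVec _; exact norm_wirtVec _]

theorem norm_innerVec (i : (Fin n × Fin n) × Bool) : ‖(innerVec i).1‖ + ‖(innerVec i).2‖ ≤ 1 := by
  unfold innerVec; split_ifs <;> [exact norm_wirtVec _; exact norm_wirtBarVec _]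

theorem quadKernel_euler {A a : Fin n → Fin n → ℂ} (hA : ∀ k l, conj (A k l) = A l k)
    (hAa : ∀ k l, ∑ m, A k m * a m l = if k = l then 1 else 0)
    (haA : ∀ k l, ∑ m, a k m * A m l = if k = l then 1 else 0)
    (T : EuclideanSpace ℂ (Fin n) →L[ℝ] ℂ) (y : EuclideanSpace ℂ (Fin n)) :
    quadKernel profile (hermBilin A) y * T y
      = - ∑ i : (Fin n × Fin n) × Bool, a i.1.2 i.1.1
        * ((T (innerVec i).1 + Complex.I * T (innerVec i).2)
          * cderiv (outerVec i) (quadKernel profilePrim (hermBilin A)) y) := by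
  have hs1 : ∀ k, ∑ l, a l k * ∑ j, A j l * y j = y k := by
    intro k
    simp_rw [Finset.mul_sum]
    rw [Finset.sum_comm]
    have : ∀ j, ∑ l, a l k * (A j l * y j) = (if j = k then 1 else 0) * y j := by
      intro j
      rw [← hAa j k, Finset.sum_mul]
      exact Finset.sum_congr rfl fun l _ => by ring
    simp [this]
  have hs2 : ∀ l, ∑ k, a l k * conj (∑ j, A j k * y j) = conj (y l) := by
    intro l
    simp_rw [map_sum, map_mul, hA, Finset.mul_sum]
    rw [Finset.sum_comm]
    have : ∀ j, ∑ k, a l k * (A k j * conj (y j)) = (if l = j then 1 else 0) * conj (y j) := by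
      intro j
      rw [← haA l j, Finset.sum_mul]
      exact Finset.sum_congr rfl fun k _ => by ring
    simp [this]
  have hd := cderiv_quadKernel hasDerivAt_profilePrim (hermBilin_symm hA)
  have key : ∑ i : (Fin n × Fin n) × Bool, a i.1.2 i.1.1
        * ((T (innerVec i).1 + Complex.I * T (innerVec i).2)
          * cderiv (outerVec i) (quadKernel profilePrim (hermBilin A)) y)
      = - (profile (hermBilin A y y / 2) : ℂ)
        * ((∑ k, (T (wirtVec k).1 + Complex.I * T (wirtVec k).2)
            * ∑ l, a l k * ∑ j, A j l * y j)
          + ∑ l, (T (wirtBarVec l).1 + Complex.I * T (wirtBarVec l).2)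
            * ∑ k, a l k * conj (∑ j, A j k * y j)) := by
    rw [Fintype.sum_prod_type, Fintype.sum_prod_type]
    simp only [Fintype.sum_bool, innerVec, outerVec, if_true, Bool.false_eq_true, if_false, hd,
      hermBilin_wirtBarVec, hermBilin_wirtVec, Finset.sum_add_distrib]
    rw [mul_add]
    refine congrArg₂ (· + ·) ?_ ?_
    · rw [Finset.mul_sum]
      refine Finset.sum_congr rfl fun k _ => ?_
      rw [Finset.mul_sum, Finset.mul_sum]
      refine Finset.sum_congr rfl fun l _ => ?_
      generalize ∑ j, A j l * y j = s
      push_cast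
      ring
    · rw [Finset.sum_comm]
      rw [Finset.mul_sum]
      refine Finset.sum_congr rfl fun l _ => ?_
      rw [Finset.mul_sum, Finset.mul_sum]
      refine Finset.sum_congr rfl fun k _ => ?_
      generalize ∑ j, A j k * y j = s
      push_cast
      ring
  rw [key, apply_eq_sum_wirtVec T y, Finset.sum_add_distrib]
  simp only [hs1, hs2, quadKernel]
  rw [neg_mul, neg_neg]
  congr 2 <;> exact Finset.sum_congr rfl fun k _ => mul_comm _ _

end Wirtinger

section RegularSystem

open Metric Set Filter Topology ComplexConjugate
open scoped ContDiff

variable {n : ℕ}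

/-- Globally smooth extensions `g`, `a` of a uniformly positive Hermitian matrix function and of
its inverse, with a quadratic bound for the source of the associated elliptic system on the ball
of radius `7 / 8`. -/
structure RegularSystem (n : ℕ) (α σ M K₀ : ℝ)
    (g a : Fin n → Fin n → EuclideanSpace ℂ (Fin n) → ℂ) : Prop where
  contDiff_metric : ∀ k l, ContDiff ℝ ∞ (g k l)
  contDiff_inverse : ∀ k l, ContDiff ℝ ∞ (a k l)
  hermitian : ∀ z ∈ ball (0 : EuclideanSpace ℂ (Fin n)) (7 / 8), ∀ k l,
    conj (g k l z) = g l k z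
  metric_mul_inverse : ∀ z ∈ ball (0 : EuclideanSpace ℂ (Fin n)) (7 / 8), ∀ k l,
    ∑ m, g k m z * a m l z = if k = l then 1 else 0
  inverse_mul_metric : ∀ z ∈ ball (0 : EuclideanSpace ℂ (Fin n)) (7 / 8), ∀ k l,
    ∑ m, a k m z * g m l z = if k = l then 1 else 0
  lower : ∀ z ∈ ball (0 : EuclideanSpace ℂ (Fin n)) (7 / 8), ∀ y : EuclideanSpace ℂ (Fin n),
    σ⁻¹ * ‖y‖ ^ 2 ≤ (∑ k, ∑ l, g k l z * y k * conj (y l)).re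
  upper : ∀ z ∈ ball (0 : EuclideanSpace ℂ (Fin n)) (7 / 8), ∀ y : EuclideanSpace ℂ (Fin n),
    (∑ k, ∑ l, g k l z * y k * conj (y l)).re ≤ σ * ‖y‖ ^ 2
  norm_metric : ∀ z ∈ ball (0 : EuclideanSpace ℂ (Fin n)) (7 / 8), ∀ k l, ‖g k l z‖ ≤ 2 * σ
  norm_inverse : ∀ z ∈ ball (0 : EuclideanSpace ℂ (Fin n)) (7 / 8), ∀ k l, ‖a k l z‖ ≤ σ
  holder : ∀ z ∈ ball (0 : EuclideanSpace ℂ (Fin n)) (7 / 8),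
    ∀ w ∈ ball (0 : EuclideanSpace ℂ (Fin n)) (7 / 8), ∀ k l,
    ‖g k l z - g k l w‖ ≤ M * ‖z - w‖ ^ α
  source : ∀ z ∈ ball (0 : EuclideanSpace ℂ (Fin n)) (7 / 8), ∀ i j,
    ‖∑ k, ∑ l, a l k z * cderiv (wirtVec k) (cderiv (wirtBarVec l) (g i j)) z‖
      ≤ K₀ * (1 + (∑ k, ∑ l, ‖fderiv ℝ (g k l) z‖) ^ 2)

/-- The sum of the norms of the derivatives of the entries of `g`. -/
noncomputable def gradSum (g : Fin n → Fin n → EuclideanSpace ℂ (Fin n) → ℂ)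
    (z : EuclideanSpace ℂ (Fin n)) : ℝ := ∑ k, ∑ l, ‖fderiv ℝ (g k l) z‖

theorem norm_fderiv_le_gradSum (g : Fin n → Fin n → EuclideanSpace ℂ (Fin n) → ℂ)
    (z : EuclideanSpace ℂ (Fin n)) (k l : Fin n) : ‖fderiv ℝ (g k l) z‖ ≤ gradSum g z :=
  (Finset.single_le_sum (f := fun l => ‖fderiv ℝ (g k l) z‖) (fun _ _ => norm_nonneg _)
    (Finset.mem_univ l)).trans
  (Finset.single_le_sum (f := fun k => ∑ l, ‖fderiv ℝ (g k l) z‖)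
    (fun _ _ => Finset.sum_nonneg fun _ _ => norm_nonneg _) (Finset.mem_univ k))

theorem gradSum_nonneg (g : Fin n → Fin n → EuclideanSpace ℂ (Fin n) → ℂ)
    (z : EuclideanSpace ℂ (Fin n)) : 0 ≤ gradSum g z :=
  Finset.sum_nonneg fun _ _ => Finset.sum_nonneg fun _ _ => norm_nonneg _

theorem sub_eq_neg_sum_of_inverse {A G A' G' : Fin n → Fin n → ℂ}
    (h : ∀ k l, ∑ m, A k m * G m l = if k = l then 1 else 0)
    (h' : ∀ k l, ∑ m, G' k m * A' m l = if k = l then 1 else 0) (l k : Fin n) :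
    A l k - A' l k = - ∑ j, ∑ m, A l m * (G m j - G' m j) * A' j k := by
  have e : (Matrix.of A) * (Matrix.of G) = 1 := by
    ext i j; simp [Matrix.mul_apply, Matrix.one_apply, h]
  have e' : (Matrix.of G') * (Matrix.of A') = 1 := by
    ext i j; simp [Matrix.mul_apply, Matrix.one_apply, h']
  have key : Matrix.of A - Matrix.of A'
      = - (Matrix.of A * (Matrix.of G - Matrix.of G') * Matrix.of A') := by
    rw [mul_sub, sub_mul, e, mul_assoc, e', one_mul, mul_one, neg_sub]
  have := congrFun (congrFun key l) k
  simpa only [Matrix.sub_apply, Matrix.neg_apply, Matrix.mul_apply, Matrix.of_apply,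
    Finset.sum_mul] using this

namespace RegularSystem

variable {α σ M K₀ : ℝ} {g a : Fin n → Fin n → EuclideanSpace ℂ (Fin n) → ℂ}

theorem norm_inverse_sub_le (h : RegularSystem n α σ M K₀ g a) (hσ : 1 ≤ σ)
    {x z : EuclideanSpace ℂ (Fin n)} (hx : x ∈ ball 0 (7 / 8)) (hz : z ∈ ball 0 (7 / 8))
    (k l : Fin n) : ‖a k l x - a k l z‖ ≤ (n ^ 2 * σ ^ 2 * M) * ‖x - z‖ ^ α := by
  rw [sub_eq_neg_sum_of_inverse (h.inverse_mul_metric x hx) (h.metric_mul_inverse z hz), norm_neg]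
  refine (norm_sum_le_of_le _ fun j _ => norm_sum_le_of_le _ fun m _ =>
    (?_ : _ ≤ σ * (M * ‖x - z‖ ^ α) * σ)).trans_eq ?_
  · rw [norm_mul, norm_mul]
    gcongr
    · exact mul_nonneg (by linarith) ((norm_nonneg _).trans (h.holder x hx z hz m j))
    · exact h.norm_inverse x hx k m
    · exact h.holder x hx z hz m j
    · exact h.norm_inverse z hz j l
  · simp only [Finset.sum_const, Finset.card_univ, Fintype.card_fin, nsmul_eq_mul]
    ring

theorem norm_fderiv_inverse_le (h : RegularSystem n α σ M K₀ g a) (hσ : 1 ≤ σ)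
    {x : EuclideanSpace ℂ (Fin n)} (hx : x ∈ ball 0 (7 / 8)) (k l : Fin n) :
    ‖fderiv ℝ (a k l) x‖ ≤ σ ^ 2 * gradSum g x := by
  have hev : a k l =ᶠ[𝓝 x] fun z =>
      a k l x - ∑ j, ∑ m, a k m z * (g m j z - g m j x) * a j l x := by
    filter_upwards [isOpen_ball.mem_nhds hx] with z hz
    rw [sub_eq_add_neg, ← sub_eq_neg_sum_of_inverse (h.inverse_mul_metric z hz)
      (h.metric_mul_inverse x hx)]
    ring
  have hd : HasFDerivAt (fun z => a k l x - ∑ j, ∑ m, a k m z * (g m j z - g m j x) * a j l x)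
      (- ∑ j, ∑ m, (a j l x) • (a k m x) • fderiv ℝ (g m j) x) x := by
    refine (HasFDerivAt.fun_sum fun j _ => HasFDerivAt.fun_sum fun m _ => ?_).const_sub _
    have h1 := ((h.contDiff_inverse k m).differentiable (by simp) x).hasFDerivAt
    have h2 := ((h.contDiff_metric m j).differentiable (by simp) x).hasFDerivAt
    have h3 := ((h1.mul (h2.sub_const (g m j x))).mul_const (a j l x))
    refine h3.congr_fderiv ?_
    rw [sub_self]
    ext v
    simp
  rw [hev.fderiv_eq, hd.fderiv, norm_neg]
  refine (norm_sum_le_of_le _ fun j _ => norm_sum_le_of_le _ fun m _ =>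
    (?_ : _ ≤ σ ^ 2 * ‖fderiv ℝ (g m j) x‖)).trans_eq ?_
  · rw [norm_smul, norm_smul, pow_two, mul_assoc]
    gcongr
    · exact h.norm_inverse x hx _ _
    · exact h.norm_inverse x hx _ _
  · rw [gradSum, Finset.sum_comm]
    simp only [Finset.mul_sum]

theorem norm_divForm_le (h : RegularSystem n α σ M K₀ g a) (hσ : 1 ≤ σ)
    {x : EuclideanSpace ℂ (Fin n)} (hx : x ∈ ball 0 (7 / 8)) (i j : Fin n) :
    ‖divForm innerVec outerVec
        (fun (i : (Fin n × Fin n) × Bool) z => a i.1.2 i.1.1 z) (g i j) x‖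
      ≤ 2 * n ^ 2 * σ ^ 2 * gradSum g x ^ 2 + 2 * (K₀ * (1 + gradSum g x ^ 2)) := by
  have hsplit : divForm innerVec outerVec
        (fun (i : (Fin n × Fin n) × Bool) z => a i.1.2 i.1.1 z) (g i j) x
      = (∑ m : (Fin n × Fin n) × Bool, cderiv (outerVec m) (a m.1.2 m.1.1) x
          * cderiv (innerVec m) (g i j) x)
        + 2 * ∑ k, ∑ l, a l k x * cderiv (wirtVec k) (cderiv (wirtBarVec l) (g i j)) x := by
    have e : ∀ m : (Fin n × Fin n) × Bool,
        cderiv (outerVec m) (fun w => a m.1.2 m.1.1 w * cderiv (innerVec m) (g i j) w) x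
        = cderiv (outerVec m) (a m.1.2 m.1.1) x * cderiv (innerVec m) (g i j) x
          + a m.1.2 m.1.1 x * cderiv (outerVec m) (cderiv (innerVec m) (g i j)) x := fun m =>
      cderiv_mul _ ((h.contDiff_inverse _ _).differentiable (by simp) x)
        ((contDiff_cderiv _ (h.contDiff_metric i j)).differentiable (by simp) x)
    rw [divForm, Finset.sum_congr rfl fun m _ => e m, Finset.sum_add_distrib]
    congr 1
    rw [Fintype.sum_prod_type, Fintype.sum_prod_type]
    simp only [Fintype.sum_bool, innerVec, outerVec, if_true, Bool.false_eq_true, if_false,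
      Finset.mul_sum]
    refine Finset.sum_congr rfl fun k _ => Finset.sum_congr rfl fun l _ => ?_
    rw [cderiv_comm (wirtBarVec l) (wirtVec k) (h.contDiff_metric i j)]
    ring
  rw [hsplit]
  refine (norm_add_le _ _).trans (add_le_add ?_ ?_)
  · refine (norm_sum_le_of_le _ fun m _ =>
      (?_ : _ ≤ (σ ^ 2 * gradSum g x) * gradSum g x)).trans_eq ?_
    · rw [norm_mul]
      refine mul_le_mul ?_ ?_ (norm_nonneg _) (mul_nonneg (sq_nonneg _) (gradSum_nonneg _ _))
      · refine ((norm_cderiv_le _ _ _).trans (mul_le_of_le_one_left (norm_nonneg _)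
          (norm_outerVec m))).trans (h.norm_fderiv_inverse_le hσ hx _ _)
      · exact ((norm_cderiv_le _ _ _).trans (mul_le_of_le_one_left (norm_nonneg _)
          (norm_innerVec m))).trans (norm_fderiv_le_gradSum g x i j)
    · simp only [Finset.sum_const, Finset.card_univ, Fintype.card_prod, Fintype.card_fin,
        Fintype.card_bool, nsmul_eq_mul]
      push_cast
      ring
  · rw [norm_mul, Complex.norm_ofNat]
    gcongr
    exact h.source x hx i j

/-- The real bilinear form attached to the matrix `g` at the point `x`. -/
noncomputable abbrev bilin (g : Fin n → Fin n → EuclideanSpace ℂ (Fin n) → ℂ)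
    (x : EuclideanSpace ℂ (Fin n)) := hermBilin fun k l => g k l x

variable {x : EuclideanSpace ℂ (Fin n)}

theorem bilin_symm (h : RegularSystem n α σ M K₀ g a) (hx : x ∈ ball 0 (7 / 8))
    (y e : EuclideanSpace ℂ (Fin n)) : bilin g x y e = bilin g x e y :=
  hermBilin_symm (h.hermitian x hx) y e

theorem norm_bilin_le (h : RegularSystem n α σ M K₀ g a) (hx : x ∈ ball 0 (7 / 8)) :
    ‖bilin g x‖ ≤ 2 * (n ^ 2 * (2 * σ)) := norm_hermBilin_le _ (h.norm_metric x hx)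

theorem norm_bilin_sub_le (h : RegularSystem n α σ M K₀ g a) (hx : x ∈ ball 0 (7 / 8))
    {x' : EuclideanSpace ℂ (Fin n)} (hx' : x' ∈ ball 0 (7 / 8)) :
    ‖bilin g x - bilin g x'‖ ≤ 2 * (n ^ 2 * (M * ‖x - x'‖ ^ α)) := by
  rw [hermBilin_sub]
  exact norm_hermBilin_le _ (h.holder x hx x' hx')

theorem two_lt_bilin (h : RegularSystem n α σ M K₀ g a) (hσ : 1 ≤ σ) (hx : x ∈ ball 0 (7 / 8))
    (y : EuclideanSpace ℂ (Fin n)) (hy : 2 * σ < ‖y‖) : 2 < bilin g x y y / 2 := by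
  have hl := h.lower x hx y
  have hσ0 : 0 < σ := by linarith
  have : σ⁻¹ * (2 * σ) ^ 2 ≤ σ⁻¹ * ‖y‖ ^ 2 := by gcongr
  have e : σ⁻¹ * (2 * σ) ^ 2 = 4 * σ := by field_simp; ring
  rw [hermBilin_apply]
  linarith

theorem bilin_nonneg (h : RegularSystem n α σ M K₀ g a) (hσ : 1 ≤ σ) (hx : x ∈ ball 0 (7 / 8))
    (y : EuclideanSpace ℂ (Fin n)) : 0 ≤ bilin g x y y := by
  have hl := h.lower x hx y
  have : 0 ≤ σ⁻¹ * ‖y‖ ^ 2 := by positivity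
  rw [hermBilin_apply]
  linarith

theorem bilin_le_one (h : RegularSystem n α σ M K₀ g a) (hσ : 1 ≤ σ) (hx : x ∈ ball 0 (7 / 8))
    (y : EuclideanSpace ℂ (Fin n)) (hy : ‖y‖ ≤ σ⁻¹) : bilin g x y y / 2 ≤ 1 := by
  have hl := h.upper x hx y
  have hσ0 : 0 < σ := by linarith
  have : σ * ‖y‖ ^ 2 ≤ σ * σ⁻¹ ^ 2 := by gcongr
  have e : σ * σ⁻¹ ^ 2 = σ⁻¹ := by field_simp
  have : σ⁻¹ ≤ 1 := inv_le_one_of_one_le₀ hσ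
  rw [hermBilin_apply]
  linarith

end RegularSystem

end RegularSystem

section KernelEstimates

open Metric Set Filter Topology ComplexConjugate
open scoped ContDiff

namespace RegularSystem

variable {n : ℕ} {α σ M K₀ : ℝ} {g a : Fin n → Fin n → EuclideanSpace ℂ (Fin n) → ℂ}
  {x : EuclideanSpace ℂ (Fin n)}

/-- The compactly supported kernel adapted to the matrix `g` at the point `x`. -/
noncomputable abbrev kernel (g : Fin n → Fin n → EuclideanSpace ℂ (Fin n) → ℂ)
    (x : EuclideanSpace ℂ (Fin n)) := quadKernel profile (bilin g x)

theorem contDiff_kernel (x : EuclideanSpace ℂ (Fin n)) : ContDiff ℝ ∞ (kernel g x) :=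
  contDiff_quadKernel contDiff_profile _

theorem hasCompactSupport_kernel (h : RegularSystem n α σ M K₀ g a) (hσ : 1 ≤ σ)
    (hx : x ∈ ball 0 (7 / 8)) : HasCompactSupport (kernel g x) :=
  hasCompactSupport_quadKernel (h.two_lt_bilin hσ hx) fun _ hs => profile_eq_zero hs.le

theorem cderiv_kernel_eq_zero (h : RegularSystem n α σ M K₀ g a) (hσ : 1 ≤ σ)
    (hx : x ∈ ball 0 (7 / 8)) (p : EuclideanSpace ℂ (Fin n) × EuclideanSpace ℂ (Fin n))
    (y : EuclideanSpace ℂ (Fin n)) (hy : 2 * σ < ‖y‖) : cderiv p (kernel g x) y = 0 :=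
  cderiv_quadKernel_eq_zero (h.two_lt_bilin hσ hx) hasDerivAt_profile
    (fun _ hs => deriv_profile_eq_zero hs) (h.bilin_symm hx) p hy

theorem exists_norm_derivAverage_sub_le (n : ℕ) (α σ M K₀ : ℝ) (hα : 0 < α) (hσ : 1 ≤ σ)
    (hM : 0 ≤ M) (hK₀ : 0 ≤ K₀) (μ : Measure (EuclideanSpace ℂ (Fin n))) [μ.IsAddHaarMeasure] :
    ∃ C, 0 ≤ C ∧ ∀ g a, RegularSystem n α σ M K₀ g a → ∀ i j, ∀ e : EuclideanSpace ℂ (Fin n),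
      ‖e‖ ≤ 1 → ∀ (x : EuclideanSpace ℂ (Fin n)) (R L : ℝ), 0 < R → 0 ≤ L →
      closedBall x (R * (2 * σ)) ⊆ ball 0 (7 / 8) →
      (∀ z ∈ closedBall x (R * (2 * σ)), gradSum g z ≤ L) →
      ‖derivAverage μ (g i j) (kernel g x) e x R
          - fderiv ℝ (g i j) x e * ∫ y, kernel g x y ∂μ‖
        ≤ C * (L * R ^ α + (1 + L ^ 2) * R) := by
  obtain ⟨K, hK1, hK⟩ := exists_deriv_profile_bound
  set b : ℝ := 2 * (n ^ 2 * (2 * σ)) with hb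
  set ρ : ℝ := 2 * σ with hρ
  set B : ℝ := kernelBound K b ρ with hB
  have hσ0 : 0 < σ := by linarith
  have hB0 : 0 ≤ B := by rw [hB, kernelBound]; positivity
  set V := μ.real (closedBall 0 ρ) with hV
  have hV0 : 0 ≤ V := measureReal_nonneg
  set N : ℝ := (Fintype.card ((Fin n × Fin n) × Bool) : ℝ) with hN
  set C₁ : ℝ := N * ((n ^ 2 * σ ^ 2 * M) * ρ ^ α * B * V) / α with hC₁
  set C₂ : ℝ := (2 * n ^ 2 * σ ^ 2 + 2 * K₀) * B * V with hC₂
  have hC₁0 : 0 ≤ C₁ := by positivity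
  have hC₂0 : 0 ≤ C₂ := by positivity
  refine ⟨C₁ + C₂, by positivity, fun g a h i j e he x R L hR hL hsub hgrad => ?_⟩
  have hx : x ∈ ball (0 : EuclideanSpace ℂ (Fin n)) (7 / 8) :=
    hsub (mem_closedBall_self (by positivity))
  have hc := h.two_lt_bilin hσ hx
  have hsymm := h.bilin_symm hx
  have hnb := h.norm_bilin_le hx
  have main := norm_derivAverage_sub_le μ (p := innerVec) (q := outerVec)
    (a := fun (m : (Fin n × Fin n) × Bool) z => a m.1.2 m.1.1 z)
    (u := g i j) (ψ := quadKernel profilePrim (bilin g x)) (φ := kernel g x)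
    (h.contDiff_metric i j) (fun m => h.contDiff_inverse _ _)
    (contDiff_quadKernel contDiff_profilePrim _)
    (hasCompactSupport_quadKernel hc fun _ hs => profilePrim_eq_zero hs.le)
    (contDiff_kernel x).continuous (h.hasCompactSupport_kernel hσ hx) e x
    (quadKernel_euler (h.hermitian x hx) (h.metric_mul_inverse x hx) (h.inverse_mul_metric x hx))
    (α := α) (ρ := ρ) (B := B) (A := n ^ 2 * σ ^ 2 * M) (L := L)
    (F := (2 * n ^ 2 * σ ^ 2 + 2 * K₀) * (1 + L ^ 2)) (R := R)
    hα (by positivity) hB0 (by positivity) hL (by positivity) hR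
    (fun y hy => cderiv_quadKernel_eq_zero hc hasDerivAt_profilePrim
      (fun s hs => by simp [profile_eq_zero hs.le]) hsymm _ hy)
    (fun m y hy => cderiv_cderiv_quadKernel_eq_zero hc hsymm _ _ hy)
    (fun y hy => norm_cderiv_quadKernel_profilePrim_le hK1 hsymm hnb he hy)
    (fun m y hy => norm_cderiv_cderiv_quadKernel_le hK1 hK hsymm hnb he (norm_outerVec m) hy)
    (fun m z hz => (((norm_cderiv_le _ _ _).trans (mul_le_of_le_one_left (norm_nonneg _)
          (norm_innerVec m))).trans (norm_fderiv_le_gradSum g z i j)).trans (hgrad z hz))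
    (fun z hz => by
      refine (h.norm_divForm_le hσ (hsub hz) i j).trans ?_
      have h1 : gradSum g z ^ 2 ≤ L ^ 2 := by
        gcongr
        · exact gradSum_nonneg g z
        · exact hgrad z hz
      have h2 : 0 ≤ 2 * n ^ 2 * σ ^ 2 := by positivity
      nlinarith [mul_le_mul_of_nonneg_left h1 h2, mul_le_mul_of_nonneg_left h1 hK₀])
    (fun m z hz => h.norm_inverse_sub_le hσ hx (hsub hz) _ _)
  refine main.trans ?_
  have hRα : 0 ≤ R ^ α := by positivity
  have e1 : N * ((n ^ 2 * σ ^ 2 * M) * ρ ^ α * L * B * V) * R ^ α / α = C₁ * (L * R ^ α) := by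
    rw [hC₁]; ring
  have e2 : (2 * n ^ 2 * σ ^ 2 + 2 * K₀) * (1 + L ^ 2) * B * V * R = C₂ * ((1 + L ^ 2) * R) := by
    rw [hC₂]; ring
  rw [e1, e2]
  have h3 : 0 ≤ L * R ^ α := by positivity
  have h4 : 0 ≤ (1 + L ^ 2) * R := by positivity
  nlinarith [mul_nonneg hC₁0 h4, mul_nonneg hC₂0 h3]

theorem exists_norm_derivAverage_le (n : ℕ) (α σ M K₀ : ℝ) (hα : 0 < α) (hσ : 1 ≤ σ)
    (hM : 0 ≤ M) (μ : Measure (EuclideanSpace ℂ (Fin n))) [μ.IsAddHaarMeasure] :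
    ∃ C, 0 ≤ C ∧ ∀ g a, RegularSystem n α σ M K₀ g a → ∀ i j, ∀ e : EuclideanSpace ℂ (Fin n),
      ‖e‖ ≤ 1 → ∀ (x : EuclideanSpace ℂ (Fin n)) (R : ℝ), 0 < R →
      closedBall x (R * (2 * σ)) ⊆ ball 0 (7 / 8) →
      ‖derivAverage μ (g i j) (kernel g x) e x R‖ ≤ C * R ^ (α - 1) := by
  obtain ⟨K, hK1, hK⟩ := exists_deriv_profile_bound
  set b : ℝ := 2 * (n ^ 2 * (2 * σ)) with hb
  set ρ : ℝ := 2 * σ with hρ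
  set B : ℝ := kernelBound K b ρ with hB
  have hσ0 : 0 < σ := by linarith
  have hB0 : 0 ≤ B := by rw [hB, kernelBound]; positivity
  set V := μ.real (closedBall 0 ρ) with hV
  have hV0 : 0 ≤ V := measureReal_nonneg
  refine ⟨M * ρ ^ α * B * V, by positivity, fun g a h i j e he x R hR hsub => ?_⟩
  have hx : x ∈ ball (0 : EuclideanSpace ℂ (Fin n)) (7 / 8) :=
    hsub (mem_closedBall_self (by positivity))
  refine (norm_derivAverage_le μ (h.contDiff_metric i j) (contDiff_kernel x)
    (h.hasCompactSupport_kernel hσ hx) e x (ρ := ρ) (B := B) (D := M * (R * ρ) ^ α) hR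
    (by positivity) (h.cderiv_kernel_eq_zero hσ hx _)
    (fun y hy => norm_cderiv_quadKernel_profile_le hK1 hK (h.bilin_symm hx) (h.norm_bilin_le hx)
      he hy) fun y hy => ?_).trans_eq ?_
  · have hxy : ‖x + R • y - x‖ ≤ R * ρ := by
      rw [add_sub_cancel_left, norm_smul, Real.norm_of_nonneg hR.le]
      gcongr
    refine (h.holder _ (hsub ?_) x hx i j).trans ?_
    · rwa [mem_closedBall, dist_eq_norm]
    · gcongr
  · rw [Real.mul_rpow hR.le (by positivity), Real.rpow_sub hR, Real.rpow_one]
    field_simp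
    rfl

theorem exists_gradSum_le (n : ℕ) (α σ M K₀ : ℝ) (hα : 0 < α) (hσ : 1 ≤ σ)
    (hM : 0 ≤ M) (hK₀ : 0 ≤ K₀) :
    ∃ C, 0 ≤ C ∧ ∀ g a, RegularSystem n α σ M K₀ g a →
      ∀ (x : EuclideanSpace ℂ (Fin n)) (R L : ℝ), 0 < R → 0 ≤ L →
      closedBall x (R * (2 * σ)) ⊆ ball 0 (7 / 8) →
      (∀ z ∈ closedBall x (R * (2 * σ)), gradSum g z ≤ L) →
      gradSum g x ≤ C * (R ^ (α - 1) + L * R ^ α + (1 + L ^ 2) * R) := by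
  set μ : Measure (EuclideanSpace ℂ (Fin n)) := Measure.addHaar with hμ
  obtain ⟨C₁, hC₁0, hC₁⟩ := exists_norm_derivAverage_sub_le n α σ M K₀ hα hσ hM hK₀ μ
  obtain ⟨C₂, hC₂0, hC₂⟩ := exists_norm_derivAverage_le n α σ M K₀ hα hσ hM μ
  have hσ0 : 0 < σ := by linarith
  set m := μ.real (closedBall 0 σ⁻¹) with hm
  have hm0 : 0 < m := by
    rw [hm, measureReal_def]
    exact ENNReal.toReal_pos (measure_closedBall_pos μ 0 (by positivity)).ne'
      measure_closedBall_lt_top.ne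
  refine ⟨n ^ 2 * ((C₁ + C₂) / m), by positivity, fun g a h x R L hR hL hsub hgrad => ?_⟩
  have hx : x ∈ ball (0 : EuclideanSpace ℂ (Fin n)) (7 / 8) :=
    hsub (mem_closedBall_self (by positivity))
  set X := R ^ (α - 1) + L * R ^ α + (1 + L ^ 2) * R with hX
  have hentry : ∀ i j, ‖fderiv ℝ (g i j) x‖ ≤ (C₁ + C₂) / m * X := by
    intro i j
    refine ContinuousLinearMap.opNorm_le_of_unit_norm (by positivity) fun e he => ?_
    have h1 := hC₁ g a h i j e he.le x R L hR hL hsub hgrad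
    have h2 := hC₂ g a h i j e he.le x R hR hsub
    have h3 := le_norm_integral_quadKernel (h.two_lt_bilin hσ hx) μ (h.bilin_nonneg hσ hx)
      (h.bilin_le_one hσ hx)
    have h4 : ‖fderiv ℝ (g i j) x e‖ * m ≤ (C₁ + C₂) * X := by
      calc ‖fderiv ℝ (g i j) x e‖ * m
          ≤ ‖fderiv ℝ (g i j) x e‖ * ‖∫ y, kernel g x y ∂μ‖ := by gcongr
        _ = ‖fderiv ℝ (g i j) x e * ∫ y, kernel g x y ∂μ‖ := (norm_mul _ _).symm
        _ ≤ C₁ * (L * R ^ α + (1 + L ^ 2) * R) + C₂ * R ^ (α - 1) := by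
          rw [norm_sub_rev] at h1
          have := norm_le_norm_add_norm_sub' (fderiv ℝ (g i j) x e * ∫ y, kernel g x y ∂μ)
            (derivAverage μ (g i j) (kernel g x) e x R)
          linarith
        _ ≤ (C₁ + C₂) * X := by
          have e1 : 0 ≤ R ^ (α - 1) := by positivity
          have e2 : 0 ≤ L * R ^ α + (1 + L ^ 2) * R := by positivity
          rw [hX]
          nlinarith [mul_nonneg hC₁0 e1, mul_nonneg hC₂0 e2]
    rw [div_mul_eq_mul_div, le_div_iff₀ hm0]
    exact h4
  calc gradSum g x ≤ ∑ i : Fin n, ∑ j : Fin n, (C₁ + C₂) / m * X :=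
        Finset.sum_le_sum fun i _ => Finset.sum_le_sum fun j _ => hentry i j
    _ = _ := by
        simp only [Finset.sum_const, Finset.card_univ, Fintype.card_fin, nsmul_eq_mul]
        ring

end RegularSystem

end KernelEstimates

section InteriorEstimates

open Metric Set Filter Topology ComplexConjugate
open scoped ContDiff

theorem exists_mul_le_of_forall_scale_le {C ρ α : ℝ} (hC : 0 ≤ C) (hρ : 0 ≤ ρ) (hα : 0 < α) :
    ∃ S, 0 ≤ S ∧ ∀ L d : ℝ, 0 < d → d ≤ 1 →
      (∀ R, 0 < R → R * ρ ≤ d / 2 →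
        L ≤ C * (R ^ (α - 1) + 2 * L * R ^ α + (1 + (2 * L) ^ 2) * R)) → d * L ≤ S := by
  set ε : ℝ := 1 / (10 * C + 1) with hε
  have hε0 : 0 < ε := by positivity
  have hCε : 5 * C * ε ≤ 1 / 2 := by
    rw [hε, mul_one_div, div_le_div_iff₀ (by positivity) (by norm_num)]
    linarith
  set C' : ℝ := C * (ε ^ (α - 1) + 2 * ε ^ α) with hC'
  have hC'0 : 0 ≤ C' := by positivity
  refine ⟨1 + 2 * (ε * ρ) + (2 * C') ^ (1 / α), by positivity, fun L d hd hd1 h => ?_⟩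
  have p1 : 0 ≤ 2 * (ε * ρ) := by positivity
  have p2 : 0 ≤ (2 * C') ^ (1 / α) := by positivity
  rcases le_total L 1 with hL | hL
  · nlinarith
  have hL0 : 0 < L := by linarith
  rcases lt_or_ge (d / 2) (ε / L * ρ) with hlt | hge
  · rw [div_mul_eq_mul_div, lt_div_iff₀ hL0] at hlt
    linarith
  have h1 := h (ε / L) (by positivity) hge
  have e1 : (ε / L) ^ (α - 1) = ε ^ (α - 1) * (L / L ^ α) := by
    rw [Real.div_rpow hε0.le hL0.le, Real.rpow_sub hL0, Real.rpow_one, div_eq_mul_inv, inv_div]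
  have e2 : 2 * L * (ε / L) ^ α = 2 * ε ^ α * (L / L ^ α) := by
    rw [Real.div_rpow hε0.le hL0.le]
    ring
  have e3 : (1 + (2 * L) ^ 2) * (ε / L) ≤ 5 * ε * L := by
    rw [← mul_div_assoc, div_le_iff₀ hL0]
    nlinarith [mul_nonneg hε0.le (by nlinarith : (0:ℝ) ≤ L ^ 2 - 1)]
  rw [e1, e2] at h1
  have h2 : L ≤ C' * (L / L ^ α) + L / 2 := by
    calc L ≤ _ := h1
      _ ≤ C * (ε ^ (α - 1) * (L / L ^ α) + 2 * ε ^ α * (L / L ^ α) + 5 * ε * L) := by gcongr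
      _ = C' * (L / L ^ α) + (5 * C * ε) * L := by rw [hC']; ring
      _ ≤ C' * (L / L ^ α) + 1 / 2 * L := by gcongr
      _ = _ := by ring
  have hLα : 0 < L ^ α := by positivity
  have h3 : L ^ α ≤ 2 * C' := by
    have : L * L ^ α ≤ L * (2 * C') := by
      have h4 : L / 2 ≤ C' * L / L ^ α := by rw [mul_div_assoc]; linarith
      rw [le_div_iff₀ hLα] at h4
      linarith
    exact le_of_mul_le_mul_left this hL0
  have h5 : L ≤ (2 * C') ^ (1 / α) := by
    calc L = (L ^ α) ^ (1 / α) := by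
          rw [← Real.rpow_mul hL0.le, mul_one_div_cancel hα.ne', Real.rpow_one]
      _ ≤ _ := by gcongr
  nlinarith

namespace RegularSystem

theorem exists_gradSum_le_const (n : ℕ) (α σ M K₀ : ℝ) (hα : 0 < α) (hσ : 1 ≤ σ)
    (hM : 0 ≤ M) (hK₀ : 0 ≤ K₀) :
    ∃ C, 0 ≤ C ∧ ∀ g a, RegularSystem n α σ M K₀ g a →
      ∀ z ∈ closedBall (0 : EuclideanSpace ℂ (Fin n)) (5 / 8), gradSum g z ≤ C := by
  obtain ⟨C, hC0, hC⟩ := exists_gradSum_le n α σ M K₀ hα hσ hM hK₀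
  obtain ⟨S, hS0, hS⟩ := exists_mul_le_of_forall_scale_le hC0 (by linarith : 0 ≤ 2 * σ) hα
  refine ⟨8 * S, by positivity, fun g a h => ?_⟩
  have hcont : Continuous (gradSum g) := by
    unfold gradSum
    exact continuous_finsetSum _ fun i _ => continuous_finsetSum _ fun j _ =>
      ((h.contDiff_metric i j).continuous_fderiv (by simp)).norm
  obtain ⟨x, hx, hmax⟩ := (isCompact_closedBall (0 : EuclideanSpace ℂ (Fin n)) (3 / 4)).exists_isMaxOn
    ⟨0, by simp; norm_num⟩ (f := fun z => (3 / 4 - ‖z‖) * gradSum g z)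
    ((continuous_const.sub continuous_norm).mul hcont).continuousOn
  have hbound : (3 / 4 - ‖x‖) * gradSum g x ≤ S := by
    rw [mem_closedBall_zero_iff] at hx
    rcases eq_or_lt_of_le hx with h0 | h0
    · rw [h0, sub_self, zero_mul]; exact hS0
    set d := 3 / 4 - ‖x‖ with hd
    have hd0 : 0 < d := by linarith
    refine hS _ d hd0 (by linarith [norm_nonneg x]) fun R hR hRd => ?_
    have hin : ∀ z ∈ closedBall x (R * (2 * σ)), d / 2 ≤ 3 / 4 - ‖z‖ := by
      intro z hz
      rw [mem_closedBall, dist_eq_norm] at hz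
      have := norm_le_norm_add_norm_sub' z x
      linarith
    refine hC g a h x R _ hR (mul_nonneg zero_le_two (gradSum_nonneg g x)) (fun z hz => ?_)
      fun z hz => ?_
    · have := hin z hz
      rw [mem_ball_zero_iff]
      linarith
    · have h1 := hin z hz
      have h2 : (3 / 4 - ‖z‖) * gradSum g z ≤ d * gradSum g x :=
        hmax (mem_closedBall_zero_iff.2 (by linarith))
      have h3 : d / 2 * gradSum g z ≤ d * gradSum g x :=
        (mul_le_mul_of_nonneg_right h1 (gradSum_nonneg g z)).trans h2
      refine le_of_mul_le_mul_left (?_ : d / 2 * _ ≤ d / 2 * _) (by positivity)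
      linarith
  intro z hz
  rw [mem_closedBall_zero_iff] at hz
  have h2 : (3 / 4 - ‖z‖) * gradSum g z ≤ (3 / 4 - ‖x‖) * gradSum g x :=
    hmax (mem_closedBall_zero_iff.2 (by linarith))
  have h3 : 1 / 8 * gradSum g z ≤ (3 / 4 - ‖z‖) * gradSum g z :=
    mul_le_mul_of_nonneg_right (by linarith) (gradSum_nonneg g z)
  linarith

theorem exists_fderiv_sub_le (n : ℕ) (α σ M K₀ : ℝ) (hα : 0 < α) (hα1 : α < 1) (hσ : 1 ≤ σ)
    (hM : 0 ≤ M) (hK₀ : 0 ≤ K₀) :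
    ∃ C, 0 ≤ C ∧ ∀ g a, RegularSystem n α σ M K₀ g a →
      ∀ i j, ∀ e : EuclideanSpace ℂ (Fin n), ‖e‖ ≤ 1 →
      ∀ x ∈ ball (0 : EuclideanSpace ℂ (Fin n)) (1 / 2),
      ∀ x' ∈ ball (0 : EuclideanSpace ℂ (Fin n)) (1 / 2),
      ‖fderiv ℝ (g i j) x e - fderiv ℝ (g i j) x' e‖ ≤ C * ‖x - x'‖ ^ (α / 2) := by
  set μ : Measure (EuclideanSpace ℂ (Fin n)) := Measure.addHaar with hμ
  obtain ⟨L, hL0, hL⟩ := exists_gradSum_le_const n α σ M K₀ hα hσ hM hK₀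
  obtain ⟨C₁, hC₁0, hC₁⟩ := exists_norm_derivAverage_sub_le n α σ M K₀ hα hσ hM hK₀ μ
  obtain ⟨K, hK1, hK⟩ := exists_deriv_profile_bound
  have hσ0 : 0 < σ := by linarith
  have hK0 : 0 ≤ K := by linarith
  set b : ℝ := 2 * (n ^ 2 * (2 * σ)) with hb
  set B : ℝ := kernelBound K b (2 * σ) with hB
  have hB0 : 0 ≤ B := by rw [hB, kernelBound]; positivity
  obtain ⟨V, hV⟩ : ∃ V, V = μ.real (closedBall 0 (2 * σ)) := ⟨_, rfl⟩
  have hV0 : 0 ≤ V := hV ▸ measureReal_nonneg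
  obtain ⟨m, hm⟩ : ∃ m, m = μ.real (closedBall 0 σ⁻¹) := ⟨_, rfl⟩
  have hm0 : 0 < m := by
    rw [hm, measureReal_def]
    exact ENNReal.toReal_pos (measure_closedBall_pos μ 0 (by positivity)).ne'
      measure_closedBall_lt_top.ne
  set A₁ : ℝ := C₁ * (L + (1 + L ^ 2)) with hA₁
  set A₂ : ℝ := K * (2 * σ) ^ 2 * (2 * (n ^ 2 * M)) * V with hA₂
  set A₃ : ℝ := 16 * σ * (L * B * V) with hA₃
  refine ⟨(2 * A₁ + 2 * (L * A₂) + A₃) / m, by positivity,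
    fun g a h i j e he x hx x' hx' => ?_⟩
  rw [mem_ball_zero_iff] at hx hx'
  rcases eq_or_ne x x' with rfl | hne
  · simp only [sub_self, norm_zero]
    positivity
  set t := ‖x - x'‖ with ht
  have ht0 : 0 < t := norm_pos_iff.2 (sub_ne_zero.2 hne)
  have ht1 : t ≤ 1 := (norm_sub_le _ _).trans (by linarith)
  set R : ℝ := t ^ (1 / 2 : ℝ) / (16 * σ) with hR
  have hR0 : 0 < R := by positivity
  have hRσ : R * (2 * σ) = t ^ (1 / 2 : ℝ) / 8 := by rw [hR]; field_simp; norm_num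
  have hs1 : t ^ (1 / 2 : ℝ) ≤ 1 := Real.rpow_le_one ht0.le ht1 (by norm_num)
  have hRs : R ≤ t ^ (1 / 2 : ℝ) := div_le_self (by positivity) (by linarith)
  have hRα : R ^ α ≤ t ^ (α / 2) := by
    calc R ^ α ≤ (t ^ (1 / 2 : ℝ)) ^ α := by gcongr
      _ = _ := by rw [← Real.rpow_mul ht0.le]; congr 1; ring
  have hR1 : R ≤ t ^ (α / 2) := hRs.trans (Real.rpow_le_rpow_of_exponent_ge ht0 ht1 (by linarith))
  have htα : t ^ α ≤ t ^ (α / 2) := Real.rpow_le_rpow_of_exponent_ge ht0 ht1 (by linarith)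
  have hRt : R⁻¹ * t ≤ 16 * σ * t ^ (α / 2) := by
    have : R⁻¹ * t = 16 * σ * t ^ (1 / 2 : ℝ) := by
      have e : t = t ^ (1 / 2 : ℝ) * t ^ (1 / 2 : ℝ) := by
        rw [← Real.rpow_add ht0]; norm_num
      rw [hR, inv_div, div_mul_eq_mul_div, div_eq_iff (by positivity)]
      nth_rewrite 1 [e]
      ring
    rw [this]
    gcongr ?_ * ?_
    exact Real.rpow_le_rpow_of_exponent_ge ht0 ht1 (by linarith)
  have hsub : ∀ w : EuclideanSpace ℂ (Fin n), ‖w‖ < 1 / 2 →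
      closedBall w (R * (2 * σ)) ⊆ closedBall 0 (5 / 8) := by
    intro w hw z hz
    rw [mem_closedBall, dist_eq_norm, hRσ] at hz
    rw [mem_closedBall_zero_iff]
    have := norm_le_norm_add_norm_sub' z w
    linarith
  have hsub' : closedBall (0 : EuclideanSpace ℂ (Fin n)) (5 / 8) ⊆ ball 0 (7 / 8) :=
    closedBall_subset_ball (by norm_num)
  have hx8 : x ∈ ball (0 : EuclideanSpace ℂ (Fin n)) (7 / 8) :=
    mem_ball_zero_iff.2 (by linarith)
  have hx8' : x' ∈ ball (0 : EuclideanSpace ℂ (Fin n)) (7 / 8) :=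
    mem_ball_zero_iff.2 (by linarith)
  have hpt : ∀ w : EuclideanSpace ℂ (Fin n), ‖w‖ < 1 / 2 → ∀ y : EuclideanSpace ℂ (Fin n),
      ‖y‖ ≤ 2 * σ → w + R • y ∈ closedBall (0 : EuclideanSpace ℂ (Fin n)) (5 / 8) := by
    intro w hw y hy
    refine hsub w hw ?_
    rw [mem_closedBall, dist_eq_norm, add_sub_cancel_left, norm_smul, Real.norm_of_nonneg hR0.le]
    gcongr
  have hentry : ∀ z ∈ closedBall (0 : EuclideanSpace ℂ (Fin n)) (5 / 8),
      ‖fderiv ℝ (g i j) z‖ ≤ L := fun z hz =>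
    (norm_fderiv_le_gradSum g z i j).trans (hL g a h z hz)
  have hdir : ∀ z ∈ closedBall (0 : EuclideanSpace ℂ (Fin n)) (5 / 8),
      ‖fderiv ℝ (g i j) z e‖ ≤ L := fun z hz =>
    ((fderiv ℝ (g i j) z).le_of_opNorm_le (hentry z hz) e).trans
      (mul_le_of_le_one_right hL0 he)
  have hpart : ∀ w : EuclideanSpace ℂ (Fin n), ‖w‖ < 1 / 2 →
      ‖derivAverage μ (g i j) (kernel g w) e w R
          - fderiv ℝ (g i j) w e * ∫ y, kernel g w y ∂μ‖ ≤ A₁ * t ^ (α / 2) := by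
    intro w hw
    refine (hC₁ g a h i j e he w R L hR0 hL0 ((hsub w hw).trans hsub')
      fun z hz => hL g a h z (hsub w hw hz)).trans ?_
    calc C₁ * (L * R ^ α + (1 + L ^ 2) * R)
        ≤ C₁ * (L * t ^ (α / 2) + (1 + L ^ 2) * t ^ (α / 2)) := by gcongr
      _ = _ := by rw [hA₁]; ring
  have hβ := h.norm_bilin_sub_le hx8 hx8'
  have hkernel : ‖derivAverage μ (g i j) (kernel g x) e x R
      - derivAverage μ (g i j) (kernel g x') e x R‖ ≤ L * A₂ * t ^ (α / 2) := by
    refine (norm_derivAverage_kernel_sub_le μ (h.contDiff_metric i j)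
      (contDiff_kernel x).continuous (h.hasCompactSupport_kernel hσ hx8)
      (contDiff_kernel x').continuous (h.hasCompactSupport_kernel hσ hx8') e x
      (ρ := 2 * σ) hL0
      (fun y hy => quadKernel_eq_zero (h.two_lt_bilin hσ hx8)
        (fun _ hs => profile_eq_zero hs.le) hy)
      (fun y hy => quadKernel_eq_zero (h.two_lt_bilin hσ hx8')
        (fun _ hs => profile_eq_zero hs.le) hy)
      (fun y hy => norm_quadKernel_profile_sub_le hK hβ hy)
      fun y hy => hdir _ (hpt x hx y hy)).trans ?_
    rw [← hV]
    calc L * (K * (2 * σ) ^ 2 * (2 * (n ^ 2 * (M * t ^ α)))) * V = L * A₂ * t ^ α := by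
          rw [hA₂]; ring
      _ ≤ _ := by gcongr
  have htrans : ‖derivAverage μ (g i j) (kernel g x') e x R
      - derivAverage μ (g i j) (kernel g x') e x' R‖ ≤ A₃ * t ^ (α / 2) := by
    refine (norm_derivAverage_translate_sub_le μ (h.contDiff_metric i j)
      (contDiff_kernel x') (h.hasCompactSupport_kernel hσ hx8') e x x'
      (ρ := 2 * σ) (B := B) (D := L * t) hR0 (by positivity)
      (h.cderiv_kernel_eq_zero hσ hx8' _)
      (fun y hy => norm_cderiv_quadKernel_profile_le hK1 hK (h.bilin_symm hx8')
        (h.norm_bilin_le hx8') he hy)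
      fun y hy => ?_).trans ?_
    · have := (convex_closedBall (0 : EuclideanSpace ℂ (Fin n))
        (5 / 8)).norm_image_sub_le_of_norm_fderiv_le (𝕜 := ℝ) (f := g i j)
        (fun z _ => (h.contDiff_metric i j).differentiable (by simp) z) hentry
        (hpt x' hx' y hy) (hpt x hx y hy)
      rwa [add_sub_add_right_eq_sub] at this
    · rw [← hV]
      calc R⁻¹ * (L * t * B * V) = (R⁻¹ * t) * (L * B * V) := by ring
        _ ≤ (16 * σ * t ^ (α / 2)) * (L * B * V) := by gcongr
        _ = _ := by rw [hA₃]; ring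
  have h_integ : ‖(∫ y, kernel g x y ∂μ) - ∫ y, kernel g x' y ∂μ‖ ≤ A₂ * t ^ (α / 2) := by
    refine (norm_integral_quadKernel_sub_le (h.two_lt_bilin hσ hx8) μ (h.two_lt_bilin hσ hx8')
      hK hβ).trans ?_
    rw [← hV]
    calc K * (2 * σ) ^ 2 * (2 * (n ^ 2 * (M * t ^ α))) * V = A₂ * t ^ α := by
          rw [hA₂]; ring
      _ ≤ _ := by gcongr
  have hlow := le_norm_integral_quadKernel (h.two_lt_bilin hσ hx8) μ (h.bilin_nonneg hσ hx8)
      (h.bilin_le_one hσ hx8)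
  rw [← hm] at hlow
  have hp := hpart x hx
  have hp' := hpart x' hx'
  have hd' := hdir x' (hsub x' hx' (mem_closedBall_self (by positivity)))
  generalize (∫ y, kernel g x y ∂μ) = I at hp h_integ hlow
  generalize (∫ y, kernel g x' y ∂μ) = I' at hp' h_integ
  generalize fderiv ℝ (g i j) x e = D at hp ⊢
  generalize fderiv ℝ (g i j) x' e = D' at hp' hd' ⊢
  generalize derivAverage μ (g i j) (kernel g x) e x R = J₁ at hp hkernel
  generalize derivAverage μ (g i j) (kernel g x') e x R = J₂ at hkernel htrans
  generalize derivAverage μ (g i j) (kernel g x') e x' R = J₃ at hp' htrans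
  have hmain : ‖(D - D') * I‖ ≤ (2 * A₁ + 2 * (L * A₂) + A₃) * t ^ (α / 2) := by
    have e : (D - D') * I = -(J₁ - D * I) + (J₁ - J₂) + (J₂ - J₃) + (J₃ - D' * I')
        + -(D' * (I - I')) := by ring
    rw [e]
    refine (norm_add_le _ _).trans ?_
    refine (add_le_add_left (norm_add₄_le) _).trans ?_
    rw [norm_neg, norm_neg, norm_mul]
    have h6 : ‖D'‖ * ‖I - I'‖ ≤ L * (A₂ * t ^ (α / 2)) := by gcongr
    linarith
  rw [div_mul_eq_mul_div, le_div_iff₀ hm0]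
  refine le_trans ?_ hmain
  rw [norm_mul]
  gcongr

end RegularSystem

end InteriorEstimates

section UniformlyPositive

open Metric Set Filter Topology ComplexConjugate
open scoped ContDiff

variable {n : ℕ}

theorem re_star_dotProduct_self (v : Fin n → ℂ) : (star v ⬝ᵥ v).re = ∑ i, ‖v i‖ ^ 2 := by
  simp only [dotProduct, Complex.re_sum, Pi.star_apply]
  refine Finset.sum_congr rfl fun i _ => ?_
  rw [← Complex.normSq_eq_norm_sq, ← Complex.ofReal_re (Complex.normSq (v i)),
    Complex.normSq_eq_conj_mul_self]
  rfl

theorem isUnit_det_of_lower {A : Matrix (Fin n) (Fin n) ℂ} {σ : ℝ} (hσ : 0 < σ)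
    (hA : ∀ v : Fin n → ℂ, σ⁻¹ * (star v ⬝ᵥ v).re ≤ (star v ⬝ᵥ A.mulVec v).re) :
    IsUnit A.det := by
  rw [isUnit_iff_ne_zero]
  intro h0
  obtain ⟨v, hv, hAv⟩ := Matrix.exists_mulVec_eq_zero_iff.2 h0
  have h1 := hA v
  rw [hAv, dotProduct_zero, Complex.zero_re, re_star_dotProduct_self] at h1
  obtain ⟨i, hi⟩ := Function.ne_iff.1 hv
  have h2 : 0 < ∑ i, ‖v i‖ ^ 2 := Finset.sum_pos' (fun _ _ => sq_nonneg _)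
    ⟨i, Finset.mem_univ i, by have := norm_pos_iff.2 hi; positivity⟩
  have : 0 < σ⁻¹ * ∑ i, ‖v i‖ ^ 2 := by positivity
  linarith

theorem norm_apply_le_of_upper {A : Matrix (Fin n) (Fin n) ℂ} {σ : ℝ} (hσ : 0 < σ)
    (hherm : A.IsHermitian)
    (hA : ∀ v : Fin n → ℂ, σ⁻¹ * (star v ⬝ᵥ v).re ≤ (star v ⬝ᵥ A.mulVec v).re)
    (hA' : ∀ v : Fin n → ℂ, (star v ⬝ᵥ A.mulVec v).re ≤ σ * (star v ⬝ᵥ v).re) (i j : Fin n) :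
    ‖A i j‖ ≤ 2 * σ := by
  have hpos : ∀ v : Fin n → ℂ, 0 ≤ (star v ⬝ᵥ A.mulVec v).re := fun v =>
    le_trans (by rw [re_star_dotProduct_self]; positivity) (hA v)
  rcases eq_or_ne (A i j) 0 with h0 | h0
  · rw [h0, norm_zero]; positivity
  have hn0 : (‖A i j‖ : ℂ) ≠ 0 := by exact_mod_cast norm_ne_zero_iff.2 h0
  set t : ℂ := conj (A i j) / ‖A i j‖ with ht
  have htn : ‖t‖ = 1 := by
    rw [ht, norm_div, RCLike.norm_conj, Complex.norm_real, norm_norm,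
      div_self (norm_ne_zero_iff.2 h0)]
  have hta : t * A i j = ‖A i j‖ := by
    rw [ht, div_mul_eq_mul_div, Complex.conj_mul', div_eq_iff hn0, sq]
  set v : Fin n → ℂ := Pi.single i 1 with hv
  set w : Fin n → ℂ := Pi.single j t with hw
  have hvw : star v ⬝ᵥ A.mulVec w = ‖A i j‖ := by
    rw [← hta, hv, hw, ← Pi.single_star, star_one, single_one_dotProduct, Matrix.mulVec_single]
    simp [mul_comm]
  have hwv : star w ⬝ᵥ A.mulVec v = ‖A i j‖ := by
    have h1 : star w ⬝ᵥ A.mulVec v = conj (t * A i j) := by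
      have h2 : A j i = conj (A i j) := (hherm.apply j i).symm
      rw [hv, hw, ← Pi.single_star, single_dotProduct, Matrix.mulVec_single, map_mul, ← h2]
      simp
    rw [h1, hta, Complex.conj_ofReal]
  have h1 := hA' (v + w)
  rw [star_add, Matrix.mulVec_add, add_dotProduct, dotProduct_add, dotProduct_add, hvw, hwv,
    ← star_add, re_star_dotProduct_self] at h1
  simp only [Complex.add_re, Complex.ofReal_re] at h1
  have h2 : ∑ k, ‖(v + w) k‖ ^ 2 ≤ ∑ k, (2 * ‖v k‖ ^ 2 + 2 * ‖w k‖ ^ 2) := by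
    refine Finset.sum_le_sum fun k _ => ?_
    have h3 : ‖(v + w) k‖ ≤ ‖v k‖ + ‖w k‖ := norm_add_le _ _
    nlinarith [sq_nonneg (‖v k‖ - ‖w k‖), norm_nonneg ((v + w) k)]
  have hsv : ∑ k, ‖v k‖ ^ 2 = 1 := by
    rw [Finset.sum_eq_single i (fun k _ hk => by simp [hv, hk]) (by simp)]
    simp [hv]
  have hsw : ∑ k, ‖w k‖ ^ 2 = 1 := by
    rw [Finset.sum_eq_single j (fun k _ hk => by simp [hw, hk]) (by simp)]
    simp [hw, htn]
  rw [Finset.sum_add_distrib, ← Finset.mul_sum, ← Finset.mul_sum, hsv, hsw] at h2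
  have h4 : σ * ∑ k, ‖(v + w) k‖ ^ 2 ≤ σ * (2 * 1 + 2 * 1) := by gcongr
  linarith [hpos v, hpos w]

theorem norm_inv_apply_le_of_lower {A : Matrix (Fin n) (Fin n) ℂ} {σ : ℝ} (hσ : 0 < σ)
    (hA : ∀ v : Fin n → ℂ, σ⁻¹ * (star v ⬝ᵥ v).re ≤ (star v ⬝ᵥ A.mulVec v).re) (i j : Fin n) :
    ‖A⁻¹ i j‖ ≤ σ := by
  set v : Fin n → ℂ := fun k => A⁻¹ k j with hv
  have hAv : A.mulVec v = Pi.single j 1 := by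
    ext k
    have := congrFun (congrFun (Matrix.mul_nonsing_inv A (isUnit_det_of_lower hσ hA)) k) j
    rw [Matrix.mul_apply] at this
    simpa [Matrix.mulVec, dotProduct, hv, Matrix.one_apply, Pi.single_apply] using this
  have h1 := hA v
  rw [hAv, dotProduct_single_one, re_star_dotProduct_self] at h1
  have hle : ∀ k, ‖v k‖ ^ 2 ≤ ∑ k, ‖v k‖ ^ 2 := fun k =>
    Finset.single_le_sum (f := fun k => ‖v k‖ ^ 2) (fun _ _ => sq_nonneg _) (Finset.mem_univ k)
  have h2 : (star v j).re ≤ ‖v j‖ := by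
    refine (Complex.re_le_norm _).trans_eq ?_
    rw [Pi.star_apply, norm_star]
  have h3 : ∑ k, ‖v k‖ ^ 2 ≤ σ * ‖v j‖ := by
    have := h1.trans h2
    rwa [inv_mul_le_iff₀ hσ] at this
  have h4 : ‖v j‖ ≤ σ := by
    by_contra! hlt
    have := (hle j).trans h3
    nlinarith
  have h5 : ‖v i‖ ^ 2 ≤ σ ^ 2 := (hle i).trans (h3.trans (by nlinarith))
  exact le_of_sq_le_sq h5 hσ.le

theorem contDiffOn_det {E : Type*} [NormedAddCommGroup E] [NormedSpace ℝ E] {s : Set E}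
    {A : E → Matrix (Fin n) (Fin n) ℂ} (hA : ∀ i j, ContDiffOn ℝ ∞ (fun z => A z i j) s) :
    ContDiffOn ℝ ∞ (fun z => (A z).det) s := by
  simp only [Matrix.det_apply]
  exact ContDiffOn.sum fun τ _ => (contDiffOn_prod fun i _ => hA _ _).const_smul _

theorem contDiffOn_inv_apply {E : Type*} [NormedAddCommGroup E] [NormedSpace ℝ E] {s : Set E}
    {A : E → Matrix (Fin n) (Fin n) ℂ} (hA : ∀ i j, ContDiffOn ℝ ∞ (fun z => A z i j) s)
    (hdet : ∀ z ∈ s, IsUnit (A z).det) (i j : Fin n) :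
    ContDiffOn ℝ ∞ (fun z => (A z)⁻¹ i j) s := by
  simp only [Matrix.inv_def, Matrix.smul_apply, Ring.inverse_eq_inv', smul_eq_mul,
    Matrix.adjugate_apply]
  refine ((contDiffOn_det hA).inv fun z hz => (hdet z hz).ne_zero).mul (contDiffOn_det ?_)
  intro k l
  rcases eq_or_ne k j with rfl | hk
  · simpa using contDiffOn_const
  · simpa [Matrix.updateRow_ne hk] using hA k l

theorem contDiff_mul_of_contDiffOn {E : Type*} [NormedAddCommGroup E] [NormedSpace ℝ E]
    {s : Set E} (hs : IsOpen s) {χ : E → ℝ} (hχ : ContDiff ℝ ∞ χ) (hχs : tsupport χ ⊆ s)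
    {f : E → ℂ} (hf : ContDiffOn ℝ ∞ f s) : ContDiff ℝ ∞ (fun z => (χ z : ℂ) * f z) := by
  rw [contDiff_iff_contDiffAt]
  intro z
  by_cases hz : z ∈ s
  · exact (Complex.ofRealCLM.contDiff.comp hχ).contDiffAt.mul (hf.contDiffAt (hs.mem_nhds hz))
  · have : (fun z => (χ z : ℂ) * f z) =ᶠ[𝓝 z] fun _ => 0 := by
      filter_upwards [(isClosed_tsupport χ).isOpen_compl.mem_nhds fun h => hz (hχs h)] with w hw
      simp [image_eq_zero_of_notMem_tsupport hw]
    exact contDiffAt_const.congr_of_eventuallyEq this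

end UniformlyPositive

section Reduction

open Metric Set Filter Topology ComplexConjugate
open scoped ContDiff

variable {n : ℕ}

theorem exists_regularSystem_of_ellipticSolution {α σ Λ M c : ℝ} (hσ : 1 ≤ σ)
    {g H : EuclideanSpace ℂ (Fin n) → Matrix (Fin n) (Fin n) ℂ}
    (h : EllipticSolution n α σ Λ M c g H) :
    ∃ g' a' : Fin n → Fin n → EuclideanSpace ℂ (Fin n) → ℂ,
      RegularSystem n α σ |M| (n ^ 4 * σ ^ 2 + 3 * σ * |Λ|) g' a' ∧
      ∀ z ∈ ball (0 : EuclideanSpace ℂ (Fin n)) (7 / 8), ∀ i j,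
        g' i j =ᶠ[𝓝 z] fun w => g w i j := by
  obtain ⟨hsmooth, hherm, hbound, -, hΛ, hholder, heq⟩ := h
  have hσ0 : 0 < σ := by linarith
  have hsub : ball (0 : EuclideanSpace ℂ (Fin n)) (7 / 8) ⊆ ball 0 1 :=
    ball_subset_ball (by norm_num)
  have hlow := fun z hz v => (hbound z hz v).1
  have hup := fun z hz v => (hbound z hz v).2
  have hdet : ∀ z ∈ ball (0 : EuclideanSpace ℂ (Fin n)) 1, IsUnit (g z).det := fun z hz =>
    isUnit_det_of_lower hσ0 (hlow z hz)
  let χ : ContDiffBump (0 : EuclideanSpace ℂ (Fin n)) := ⟨7 / 8, 15 / 16, by norm_num, by norm_num⟩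
  have hχ1 : ∀ z ∈ ball (0 : EuclideanSpace ℂ (Fin n)) (7 / 8), χ z = 1 := fun z hz =>
    χ.one_of_mem_closedBall (ball_subset_closedBall hz)
  have hχs : tsupport χ ⊆ ball (0 : EuclideanSpace ℂ (Fin n)) 1 := by
    rw [χ.tsupport_eq]
    exact closedBall_subset_ball (by norm_num [χ])
  set g' : Fin n → Fin n → EuclideanSpace ℂ (Fin n) → ℂ := fun k l z => (χ z : ℂ) * g z k l with hg'
  set a' : Fin n → Fin n → EuclideanSpace ℂ (Fin n) → ℂ :=
    fun k l z => (χ z : ℂ) * (g z)⁻¹ k l with ha'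
  have hgz : ∀ z ∈ ball (0 : EuclideanSpace ℂ (Fin n)) (7 / 8), ∀ k l, g' k l z = g z k l := by
    intro z hz k l
    simp [hg', hχ1 z hz]
  have haz : ∀ z ∈ ball (0 : EuclideanSpace ℂ (Fin n)) (7 / 8), ∀ k l, a' k l z = (g z)⁻¹ k l := by
    intro z hz k l
    simp [ha', hχ1 z hz]
  have hev : ∀ z ∈ ball (0 : EuclideanSpace ℂ (Fin n)) (7 / 8), ∀ i j,
      g' i j =ᶠ[𝓝 z] fun w => g w i j := fun z hz i j => by
    filter_upwards [isOpen_ball.mem_nhds hz] with w hw using hgz w hw i j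
  have hquad : ∀ z ∈ ball (0 : EuclideanSpace ℂ (Fin n)) (7 / 8),
      ∀ y : EuclideanSpace ℂ (Fin n), ∑ k, ∑ l, g' k l z * y k * conj (y l)
        = star (star y.ofLp) ⬝ᵥ (g z).mulVec (star y.ofLp) := by
    intro z hz y
    simp only [hgz z hz, star_star, dotProduct, Matrix.mulVec, Finset.mul_sum, Pi.star_apply]
    refine Finset.sum_congr rfl fun k _ => Finset.sum_congr rfl fun l _ => ?_
    simp only [RCLike.star_def]
    ring
  have hnorm : ∀ y : EuclideanSpace ℂ (Fin n),
      (star (star y.ofLp) ⬝ᵥ star y.ofLp).re = ‖y‖ ^ 2 := by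
    intro y
    rw [re_star_dotProduct_self, EuclideanSpace.norm_sq_eq]
    simp
  refine ⟨g', a', ⟨?_, ?_, ?_, ?_, ?_, ?_, ?_, ?_, ?_, ?_, ?_⟩, hev⟩
  · exact fun k l => contDiff_mul_of_contDiffOn isOpen_ball χ.contDiff hχs (hsmooth k l)
  · exact fun k l => contDiff_mul_of_contDiffOn isOpen_ball χ.contDiff hχs
      (contDiffOn_inv_apply hsmooth hdet k l)
  · intro z hz k l
    rw [hgz z hz, hgz z hz]
    exact (hherm z (hsub hz)).apply l k
  · intro z hz k l
    simp only [hgz z hz, haz z hz]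
    rw [← Matrix.mul_apply, Matrix.mul_nonsing_inv _ (hdet z (hsub hz)), Matrix.one_apply]
  · intro z hz k l
    simp only [hgz z hz, haz z hz]
    rw [← Matrix.mul_apply, Matrix.nonsing_inv_mul _ (hdet z (hsub hz)), Matrix.one_apply]
  · intro z hz y
    rw [hquad z hz y, ← hnorm y]
    exact hlow z (hsub hz) _
  · intro z hz y
    rw [hquad z hz y, ← hnorm y]
    exact hup z (hsub hz) _
  · intro z hz k l
    rw [hgz z hz]
    exact norm_apply_le_of_upper hσ0 (hherm z (hsub hz)) (hlow z (hsub hz)) (hup z (hsub hz)) k l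
  · intro z hz k l
    rw [haz z hz]
    exact norm_inv_apply_le_of_lower hσ0 (hlow z (hsub hz)) k l
  · intro z hz w hw k l
    rw [hgz z hz, hgz w hw]
    refine (hholder k l z (hsub hz) w (hsub hw)).trans ?_
    gcongr
    exact le_abs_self M
  · intro z hz i j
    have hderiv : ∀ p k l, cderiv p (g' k l) z = cderiv p (fun w => g w k l) z :=
      fun p k l => cderiv_congr (hev z hz k l)
    have hsecond : ∀ k l, cderiv (wirtVec k) (cderiv (wirtBarVec l) (g' i j)) z
        = wirt n k (fun w => wirtBar n l (fun w' => g w' i j) w) z := by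
      intro k l
      rw [wirt_eq_cderiv]
      refine cderiv_congr ?_
      filter_upwards [isOpen_ball.mem_nhds hz] with w hw
      rw [wirtBar_eq_cderiv]
      exact cderiv_congr (hev w hw i j)
    simp only [haz z hz, hsecond]
    rw [sub_eq_iff_eq_add.1 (heq z (hsub hz) i j)]
    change _ ≤ _ * (1 + gradSum g' z ^ 2)
    have hN := gradSum_nonneg g' z
    have hg2 := norm_apply_le_of_upper hσ0 (hherm z (hsub hz)) (hlow z (hsub hz))
      (hup z (hsub hz)) i j
    have hcΛ := hΛ z (hsub hz) i j
    have hΛabs := le_abs_self Λ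
    have hlin : ‖(c : ℂ) * g z i j + H z i j‖ ≤ 3 * σ * |Λ| := by
      refine (norm_add_le _ _).trans ?_
      rw [norm_mul, Complex.norm_real, Real.norm_eq_abs]
      have h1 : |c| * ‖g z i j‖ ≤ |c| * (2 * σ) := by gcongr
      have h2 : |c| * (2 * σ) + ‖H z i j‖ * (2 * σ) ≤ |Λ| * (2 * σ) := by
        rw [← add_mul]
        gcongr
        exact hcΛ.trans hΛabs
      nlinarith [norm_nonneg (H z i j), abs_nonneg c, abs_nonneg Λ]
    have hquadr : ‖∑ k, ∑ m, ∑ p, ∑ l, (g z)⁻¹ m k * (g z)⁻¹ l p *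
          wirt n p (fun w => g w i m) z * wirtBar n l (fun w => g w k j) z‖
        ≤ n ^ 4 * σ ^ 2 * gradSum g' z ^ 2 := by
      refine (norm_sum_le_of_le _ fun k _ => norm_sum_le_of_le _ fun m _ =>
        norm_sum_le_of_le _ fun p _ => norm_sum_le_of_le _ fun l _ =>
        (?_ : _ ≤ σ * σ * gradSum g' z * gradSum g' z)).trans_eq ?_
      · rw [wirt_eq_cderiv, wirtBar_eq_cderiv, ← hderiv, ← hderiv, norm_mul, norm_mul, norm_mul]
        gcongr
        · exact norm_inv_apply_le_of_lower hσ0 (hlow z (hsub hz)) _ _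
        · exact norm_inv_apply_le_of_lower hσ0 (hlow z (hsub hz)) _ _
        · exact ((norm_cderiv_le _ _ _).trans (mul_le_of_le_one_left (norm_nonneg _)
            (norm_wirtVec _))).trans (norm_fderiv_le_gradSum g' z _ _)
        · exact ((norm_cderiv_le _ _ _).trans (mul_le_of_le_one_left (norm_nonneg _)
            (norm_wirtBarVec _))).trans (norm_fderiv_le_gradSum g' z _ _)
      · simp only [Finset.sum_const, Finset.card_univ, Fintype.card_fin, nsmul_eq_mul]
        ring
    refine (norm_add_le _ _).trans ((add_le_add hlin hquadr).trans ?_)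
    have h3 : 0 ≤ 3 * σ * |Λ| := by positivity
    have h4 : (0 : ℝ) ≤ n ^ 4 * σ ^ 2 := by positivity
    nlinarith [mul_nonneg h3 (sq_nonneg (gradSum g' z))]

end Reduction

/-- interior `C^{1,α'}` estimate: there exist `α' ∈ (0,1)` and `C`,
depending only on `n, α, σ, Λ, M`, bounding `g`, all first-order real partial
derivatives `Dg`, and the `α'`-Hölder seminorm of `Dg` on `B_{1/2}`. -/
theorem stmt19 (n : ℕ) (hn : 1 ≤ n) (α σ Λ M : ℝ)
    (hα0 : 0 < α) (hα1 : α < 1) (hσ : 1 ≤ σ) :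
    ∃ α' C : ℝ, 0 < α' ∧ α' < 1 ∧
      ∀ (c : ℝ) (g H : EuclideanSpace ℂ (Fin n) → Matrix (Fin n) (Fin n) ℂ),
      EllipticSolution n α σ Λ M c g H →
      (∀ z ∈ Metric.ball (0 : EuclideanSpace ℂ (Fin n)) (1 / 2), ∀ i j : Fin n,
        ‖g z i j‖ ≤ C) ∧
      (∀ z ∈ Metric.ball (0 : EuclideanSpace ℂ (Fin n)) (1 / 2), ∀ i j k : Fin n,
        ‖pdx n k (fun w => g w i j) z‖ ≤ C ∧ ‖pdy n k (fun w => g w i j) z‖ ≤ C) ∧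
      (∀ z ∈ Metric.ball (0 : EuclideanSpace ℂ (Fin n)) (1 / 2),
        ∀ y ∈ Metric.ball (0 : EuclideanSpace ℂ (Fin n)) (1 / 2), ∀ i j k : Fin n,
        ‖pdx n k (fun w => g w i j) z - pdx n k (fun w => g w i j) y‖ ≤ C * ‖z - y‖ ^ α' ∧
        ‖pdy n k (fun w => g w i j) z - pdy n k (fun w => g w i j) y‖ ≤ C * ‖z - y‖ ^ α') := by
  have hK₀ : 0 ≤ n ^ 4 * σ ^ 2 + 3 * σ * |Λ| := by positivity
  obtain ⟨C₁, hC₁0, hC₁⟩ := RegularSystem.exists_gradSum_le_const n α σ |M| _ hα0 hσ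
    (abs_nonneg M) hK₀
  obtain ⟨C₂, hC₂0, hC₂⟩ := RegularSystem.exists_fderiv_sub_le n α σ |M| _ hα0 hα1 hσ
    (abs_nonneg M) hK₀
  refine ⟨α / 2, 2 * σ + C₁ + C₂, by linarith, by linarith, fun c g H hsol => ?_⟩
  obtain ⟨g', a', hreg, hev⟩ := exists_regularSystem_of_ellipticSolution hσ hsol
  have hsub : Metric.ball (0 : EuclideanSpace ℂ (Fin n)) (1 / 2) ⊆ Metric.ball 0 (7 / 8) :=
    Metric.ball_subset_ball (by norm_num)
  have hx : ∀ k : Fin n, ‖(EuclideanSpace.single k (1 : ℂ) : EuclideanSpace ℂ (Fin n))‖ ≤ 1 := by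
    simp
  have hy : ∀ k : Fin n, ‖(EuclideanSpace.single k Complex.I : EuclideanSpace ℂ (Fin n))‖ ≤ 1 := by
    simp
  have hfd : ∀ z ∈ Metric.ball (0 : EuclideanSpace ℂ (Fin n)) (1 / 2), ∀ i j : Fin n,
      fderiv ℝ (fun w => g w i j) z = fderiv ℝ (g' i j) z := fun z hz i j =>
    (hev z (hsub hz) i j).fderiv_eq.symm
  have hfirst : ∀ z ∈ Metric.ball (0 : EuclideanSpace ℂ (Fin n)) (1 / 2), ∀ i j : Fin n,
      ∀ e : EuclideanSpace ℂ (Fin n), ‖e‖ ≤ 1 →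
      ‖fderiv ℝ (fun w => g w i j) z e‖ ≤ 2 * σ + C₁ + C₂ := by
    intro z hz i j e he
    rw [hfd z hz]
    have h1 := hC₁ g' a' hreg z (Metric.ball_subset_closedBall
      (Metric.ball_subset_ball (by norm_num) hz))
    have h2 := (fderiv ℝ (g' i j) z).le_of_opNorm_le
      ((norm_fderiv_le_gradSum g' z i j).trans h1) e
    have h3 := mul_le_of_le_one_right hC₁0 he
    linarith
  have hsecond : ∀ z ∈ Metric.ball (0 : EuclideanSpace ℂ (Fin n)) (1 / 2),
      ∀ y ∈ Metric.ball (0 : EuclideanSpace ℂ (Fin n)) (1 / 2), ∀ i j : Fin n,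
      ∀ e : EuclideanSpace ℂ (Fin n), ‖e‖ ≤ 1 →
      ‖fderiv ℝ (fun w => g w i j) z e - fderiv ℝ (fun w => g w i j) y e‖
        ≤ (2 * σ + C₁ + C₂) * ‖z - y‖ ^ (α / 2) := by
    intro z hz y hy i j e he
    rw [hfd z hz, hfd y hy]
    refine (hC₂ g' a' hreg i j e he z hz y hy).trans ?_
    gcongr
    linarith
  refine ⟨fun z hz i j => ?_, fun z hz i j k => ⟨hfirst z hz i j _ (hx k), hfirst z hz i j _ (hy k)⟩,
    fun z hz y hy' i j k => ⟨hsecond z hz y hy' i j _ (hx k), hsecond z hz y hy' i j _ (hy k)⟩⟩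
  rw [← (hev z (hsub hz) i j).eq_of_nhds]
  linarith [hreg.norm_metric z (hsub hz) i j]
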